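/- arXiv:1210.7253 — 5 statements merged into one kernel-verified Lean document; each statement's English description precedes it below -/
import Mathlib

section
/- Let G = (V,E) be a finite connected unweighted graph with maximum degree Δ(G) and edge connectivity κ'(G). Then: (1) for every nonempty proper subset A ⊂ V, cut(A, V∖A) ≥ κ'(G); (2) Mcut(G) ≥ 4κ'(G)/(Δ(G)·|V|); and (3) if there is a nonempty proper subset A ⊂ V with cut(A, V∖A) = κ'(G) and 2·vol(A) = vol(G), then Mcut(G) = 4κ'(G)/vol(G). -/
open Finset

variable {n : ℕ}

/-- `cut(A, V∖A)`: the number of edges of `G` with one endpoint in `A` and the other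
in its complement. -/
def scut (G : SimpleGraph (Fin n)) [DecidableRel G.Adj] (A : Finset (Fin n)) : ℕ :=
  ∑ i ∈ A, ∑ j ∈ Aᶜ, if G.Adj i j then 1 else 0

/-- `vol(A) = ∑_{i ∈ A} d_i`, the sum of the degrees of vertices in `A`. -/
noncomputable def svol (G : SimpleGraph (Fin n)) [DecidableRel G.Adj]
    (A : Finset (Fin n)) : ℝ :=
  ∑ i ∈ A, (G.degree i : ℝ)

/-- The normalized cut `Ncut(A, V∖A) = cut(A,V∖A)·(1/vol(A) + 1/vol(V∖A))`. -/
noncomputable def sncut (G : SimpleGraph (Fin n)) [DecidableRel G.Adj]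
    (A : Finset (Fin n)) : ℝ :=
  (scut G A : ℝ) * (1 / svol G A + 1 / svol G Aᶜ)

/-- The minimum normalized cut `Mcut(G)` over all nonempty proper vertex subsets. -/
noncomputable def smcut (G : SimpleGraph (Fin n)) [DecidableRel G.Adj] : ℝ :=
  sInf {x : ℝ | ∃ A : Finset (Fin n), A.Nonempty ∧ Aᶜ.Nonempty ∧ x = sncut G A}

/-- The edge connectivity `κ'(G)` of a connected graph: the minimum of `cut(A, V∖A)`
over nonempty proper subsets `A` of the vertex set. -/
noncomputable def edgeConn (G : SimpleGraph (Fin n)) [DecidableRel G.Adj] : ℕ :=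
  sInf {j : ℕ | ∃ A : Finset (Fin n), A.Nonempty ∧ Aᶜ.Nonempty ∧ scut G A = j}

theorem edgeConn_le_scut (G : SimpleGraph (Fin n)) [DecidableRel G.Adj] {A : Finset (Fin n)}
    (hA : A.Nonempty) (hAc : Aᶜ.Nonempty) : edgeConn G ≤ scut G A :=
  Nat.sInf_le ⟨A, hA, hAc, rfl⟩

theorem svol_add_svol_compl (G : SimpleGraph (Fin n)) [DecidableRel G.Adj]
    (A : Finset (Fin n)) : svol G A + svol G Aᶜ = svol G Finset.univ :=
  Finset.sum_add_sum_compl A _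

theorem svol_univ_le (G : SimpleGraph (Fin n)) [DecidableRel G.Adj] :
    svol G Finset.univ ≤ (G.maxDegree : ℝ) * n := by
  have h := Finset.sum_le_card_nsmul Finset.univ (fun i => (G.degree i : ℝ)) (G.maxDegree : ℝ)
    fun i _ => by exact_mod_cast G.degree_le_maxDegree i
  simpa [svol, mul_comm] using h

theorem svol_pos {G : SimpleGraph (Fin n)} [DecidableRel G.Adj] (hconn : G.Connected)
    [Nontrivial (Fin n)] {A : Finset (Fin n)} (hA : A.Nonempty) : 0 < svol G A :=
  Finset.sum_pos
    (fun i _ => by exact_mod_cast hconn.preconnected.degree_pos_of_nontrivial i) hA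

theorem nontrivial_of_nonempty_compl {α : Type*} [Fintype α] [DecidableEq α] {A : Finset α}
    (hA : A.Nonempty) (hAc : Aᶜ.Nonempty) : Nontrivial α := by
  obtain ⟨a, ha⟩ := hA
  obtain ⟨b, hb⟩ := hAc
  exact ⟨a, b, fun h => Finset.mem_compl.mp hb (h ▸ ha)⟩

/-- Four over a sum is at most the sum of reciprocals. -/
theorem four_div_add_le_one_div_add_one_div {a b : ℝ} (ha : 0 < a) (hb : 0 < b) :
    4 / (a + b) ≤ 1 / a + 1 / b := by
  rw [div_add_div _ _ ha.ne' hb.ne', div_le_div_iff₀ (by positivity) (by positivity)]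
  nlinarith [sq_nonneg (a - b)]

theorem four_mul_edgeConn_div_svol_le_sncut {G : SimpleGraph (Fin n)} [DecidableRel G.Adj]
    (hconn : G.Connected) {A : Finset (Fin n)} (hA : A.Nonempty) (hAc : Aᶜ.Nonempty) :
    4 * (edgeConn G : ℝ) / svol G Finset.univ ≤ sncut G A := by
  have := nontrivial_of_nonempty_compl hA hAc
  have ha := svol_pos hconn hA
  have hb := svol_pos hconn hAc
  have hcut : (edgeConn G : ℝ) ≤ scut G A := by exact_mod_cast edgeConn_le_scut G hA hAc
  rw [← svol_add_svol_compl G A, mul_comm, mul_div_assoc, sncut]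
  exact mul_le_mul hcut (four_div_add_le_one_div_add_one_div ha hb) (by positivity)
    (by positivity)

theorem four_mul_edgeConn_div_svol_le_smcut {G : SimpleGraph (Fin n)} [DecidableRel G.Adj]
    (hconn : G.Connected) {A : Finset (Fin n)} (hA : A.Nonempty) (hAc : Aᶜ.Nonempty) :
    4 * (edgeConn G : ℝ) / svol G Finset.univ ≤ smcut G := by
  refine le_csInf ⟨_, A, hA, hAc, rfl⟩ ?_
  rintro _ ⟨B, hB, hBc, rfl⟩
  exact four_mul_edgeConn_div_svol_le_sncut hconn hB hBc

/-- For a finite connected unweighted graph `G`: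
(1) every cut has size at least `κ'(G)`;
(2) `Mcut(G) ≥ 4κ'(G)/(Δ(G)·|V|)`;
(3) if some nonempty proper `A` satisfies `cut(A,V∖A) = κ'(G)` and `2·vol(A) = vol(G)`,
then `Mcut(G) = 4κ'(G)/vol(G)`. -/
theorem mcut_edgeConn_bounds (G : SimpleGraph (Fin n)) [DecidableRel G.Adj]
    (hconn : G.Connected) :
    (∀ A : Finset (Fin n), A.Nonempty → Aᶜ.Nonempty → edgeConn G ≤ scut G A) ∧
    (4 * (edgeConn G : ℝ) / ((G.maxDegree : ℝ) * n) ≤ smcut G) ∧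
    (∀ A : Finset (Fin n), A.Nonempty → Aᶜ.Nonempty → scut G A = edgeConn G →
      2 * svol G A = svol G Finset.univ →
      smcut G = 4 * (edgeConn G : ℝ) / svol G Finset.univ) := by
  refine ⟨fun A hA hAc => edgeConn_le_scut G hA hAc, ?_, fun A hA hAc hcut hvol => ?_⟩
  · by_cases h : ∃ A : Finset (Fin n), A.Nonempty ∧ Aᶜ.Nonempty
    · obtain ⟨A, hA, hAc⟩ := h
      have := nontrivial_of_nonempty_compl hA hAc
      exact (div_le_div_of_nonneg_left (by positivity)
        (svol_pos hconn (hA.mono (Finset.subset_univ A))) (svol_univ_le G)).trans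
        (four_mul_edgeConn_div_svol_le_smcut hconn hA hAc)
    · have hκ : edgeConn G = 0 := by
        refine Nat.sInf_eq_zero.mpr (Or.inr (Set.eq_empty_of_forall_notMem ?_))
        rintro _ ⟨A, hA, hAc, -⟩
        exact h ⟨A, hA, hAc⟩
      rw [hκ, Nat.cast_zero, mul_zero, zero_div]
      refine Real.sInf_nonneg ?_
      rintro _ ⟨A, hA, hAc, -⟩
      exact absurd ⟨A, hA, hAc⟩ h
  · refine le_antisymm ?_ (four_mul_edgeConn_div_svol_le_smcut hconn hA hAc)
    have hbdd : BddBelow {x : ℝ | ∃ A : Finset (Fin n),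
        A.Nonempty ∧ Aᶜ.Nonempty ∧ x = sncut G A} := by
      refine ⟨4 * (edgeConn G : ℝ) / svol G Finset.univ, ?_⟩
      rintro _ ⟨B, hB, hBc, rfl⟩
      exact four_mul_edgeConn_div_svol_le_sncut hconn hB hBc
    refine (csInf_le hbdd ⟨A, hA, hAc, rfl⟩).trans_eq ?_
    have := nontrivial_of_nonempty_compl hA hAc
    have ha := svol_pos hconn hA
    have hb : svol G Aᶜ = svol G A := by linarith [svol_add_svol_compl G A]
    rw [sncut, hcut, hb, ← hvol]
    field_simp
    ring
end

section
/- For the cycle graph C_n with n ≥ 3, Mcut(C_n) = 4/n if n is even and Mcut(C_n) = 4n/(n² − 1) if n is odd; equivalently, Mcut(C_n) = n/(⌊n/2⌋·⌈n/2⌉). -/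
open Finset

/-- The degree of vertex `i` in a weighted graph with weight matrix `W`. -/
noncomputable def wdeg {V : Type} [Fintype V] (W : Matrix V V ℝ) (i : V) : ℝ := ∑ j, W i j

/-- `vol(A) = ∑_{i ∈ A} d_i`. -/
noncomputable def wvol {V : Type} [Fintype V] (W : Matrix V V ℝ) (A : Finset V) : ℝ :=
  ∑ i ∈ A, wdeg W i

/-- `cut(A, V∖A) = ∑_{i ∈ A, j ∉ A} w_{ij}`. -/
noncomputable def wcut {V : Type} [Fintype V] [DecidableEq V] (W : Matrix V V ℝ)
    (A : Finset V) : ℝ :=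
  ∑ i ∈ A, ∑ j ∈ Aᶜ, W i j

/-- The normalized cut `Ncut(A, V∖A) = cut(A,V∖A)·(1/vol(A) + 1/vol(V∖A))`. -/
noncomputable def wncut {V : Type} [Fintype V] [DecidableEq V] (W : Matrix V V ℝ)
    (A : Finset V) : ℝ :=
  wcut W A * (1 / wvol W A + 1 / wvol W Aᶜ)

/-- The minimum normalized cut `Mcut(G)`: the minimum of `Ncut(A, V∖A)` over all
nonempty proper subsets `A` of the vertex set. -/
noncomputable def wmcut {V : Type} [Fintype V] [DecidableEq V] (W : Matrix V V ℝ) : ℝ :=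
  sInf {x : ℝ | ∃ A : Finset V, A.Nonempty ∧ Aᶜ.Nonempty ∧ x = wncut W A}

/-- The weight (adjacency) matrix of the unweighted cycle graph `C_n` on vertices
`0, 1, ..., n-1`, with `i` adjacent to `i ± 1 (mod n)`. -/
noncomputable def cycleW (n : ℕ) : Matrix (Fin n) (Fin n) ℝ :=
  Matrix.of fun i j =>
    if i ≠ j ∧ ((i.val + 1) % n = j.val ∨ (j.val + 1) % n = i.val) then 1 else 0

lemma cycleW_apply (m : ℕ) (i j : Fin (m + 3)) :
    cycleW (m + 3) i j = (if i + 1 = j then 1 else 0) + (if i - 1 = j then 1 else 0) := by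
  have h1 : (i.val + 1) % (m + 3) = j.val ↔ i + 1 = j := by
    rw [Fin.ext_iff, Fin.val_add]; simp
  have h2 : (j.val + 1) % (m + 3) = i.val ↔ i - 1 = j := by
    rw [sub_eq_iff_eq_add, eq_comm (a := i), Fin.ext_iff, Fin.val_add]; simp
  have one_ne : (1 : Fin (m + 3)) ≠ 0 := by simp
  have two_ne : (1 : Fin (m + 3)) + 1 ≠ 0 := by
    rw [Ne, Fin.ext_iff, Fin.val_add]
    simp [Nat.mod_eq_of_lt (show 1 + 1 < m + 3 by omega)]
  simp only [cycleW, Matrix.of_apply, h1, h2]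
  by_cases ha : i + 1 = j
  · subst ha
    have : i - 1 ≠ i + 1 := fun h => two_ne (by
      rw [sub_eq_iff_eq_add, add_assoc] at h
      exact left_eq_add.mp h)
    simp [this]
  · by_cases hb : i - 1 = j
    · subst hb
      have : i ≠ i - 1 := fun h => one_ne (sub_eq_self.mp h.symm)
      simp [ha, this]
    · simp [ha, hb]

lemma wdeg_cycleW (m : ℕ) (i : Fin (m + 3)) : wdeg (cycleW (m + 3)) i = 2 := by
  simp only [wdeg, cycleW_apply, sum_add_distrib, sum_ite_eq, mem_univ, if_true]
  norm_num

lemma wvol_cycleW (m : ℕ) (A : Finset (Fin (m + 3))) :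
    wvol (cycleW (m + 3)) A = 2 * #A := by
  simp [wvol, wdeg_cycleW, mul_comm]

lemma wcut_cycleW (m : ℕ) (A : Finset (Fin (m + 3))) :
    wcut (cycleW (m + 3)) A = #{i ∈ A | i + 1 ∉ A} + #{i ∈ A | i - 1 ∉ A} := by
  simp [wcut, cycleW_apply, sum_add_distrib, -sum_boole, ← sum_boole]

open scoped Fin.CommRing in
lemma exists_mem_add_one_notMem {m : ℕ} {A : Finset (Fin (m + 3))} (hA : A.Nonempty)
    (hA' : Aᶜ.Nonempty) : ∃ i ∈ A, i + 1 ∉ A := by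
  by_contra! h
  obtain ⟨a, ha⟩ := hA
  obtain ⟨b, hb⟩ := hA'
  have key : ∀ k : ℕ, a + (k : Fin (m + 3)) ∈ A := by
    intro k
    induction k with
    | zero => simpa using ha
    | succ k ih => simpa [add_assoc] using h _ ih
  refine mem_compl.mp hb ?_
  simpa using key (b - a).val

lemma two_le_wcut_cycleW {m : ℕ} {A : Finset (Fin (m + 3))} (hA : A.Nonempty)
    (hA' : Aᶜ.Nonempty) : 2 ≤ wcut (cycleW (m + 3)) A := by
  obtain ⟨i, hi, hi'⟩ := exists_mem_add_one_notMem hA hA'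
  obtain ⟨j, hj, hj'⟩ := exists_mem_add_one_notMem hA' (by rwa [compl_compl])
  rw [mem_compl] at hj
  rw [mem_compl, not_not] at hj'
  have h1 : 0 < #{i ∈ A | i + 1 ∉ A} := card_pos.mpr ⟨i, by simp [hi, hi']⟩
  have h2 : 0 < #{i ∈ A | i - 1 ∉ A} := card_pos.mpr ⟨j + 1, by simpa using ⟨hj', hj⟩⟩
  rw [wcut_cycleW]
  exact_mod_cast (by omega : 2 ≤ #{i ∈ A | i + 1 ∉ A} + #{i ∈ A | i - 1 ∉ A})

lemma wcut_cycleW_Iio_le (m : ℕ) (k : Fin (m + 3)) :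
    wcut (cycleW (m + 3)) (Iio k) ≤ 2 := by
  have h1 : #{i ∈ Iio k | i + 1 ∉ Iio k} ≤ 1 := by
    refine card_le_one_iff_subset_singleton.mpr ⟨k - 1, fun i hi => ?_⟩
    simp only [mem_filter, mem_Iio, not_lt] at hi
    rw [mem_singleton, eq_sub_iff_add_eq]
    exact le_antisymm (Fin.add_one_le_of_lt hi.1) hi.2
  have h2 : #{i ∈ Iio k | i - 1 ∉ Iio k} ≤ 1 := by
    refine card_le_one_iff_subset_singleton.mpr ⟨0, fun i hi => ?_⟩
    simp only [mem_filter, mem_Iio, not_lt] at hi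
    rw [mem_singleton]
    by_contra h0
    exact absurd (hi.1.trans_le hi.2) (Fin.sub_one_lt_iff.mpr (Fin.pos_iff_ne_zero.mpr h0)).asymm
  rw [wcut_cycleW]
  exact_mod_cast add_le_add h1 h2

lemma wncut_cycleW {m : ℕ} {A : Finset (Fin (m + 3))} (hA : A.Nonempty) (hA' : Aᶜ.Nonempty) :
    wncut (cycleW (m + 3)) A =
      wcut (cycleW (m + 3)) A / 2 * (((m + 3 : ℕ) : ℝ) / (#A * #Aᶜ : ℕ)) := by
  have h1 : (#A : ℝ) ≠ 0 := by exact_mod_cast hA.card_pos.ne'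
  have h2 : (#Aᶜ : ℝ) ≠ 0 := by exact_mod_cast hA'.card_pos.ne'
  have h3 : ((m + 3 : ℕ) : ℝ) = #A + #Aᶜ := by
    exact_mod_cast (by simp : m + 3 = #A + #Aᶜ)
  rw [wncut, wvol_cycleW, wvol_cycleW, h3]
  push_cast
  field_simp
  ring

lemma mul_le_half_mul_half (a b : ℕ) : a * b ≤ (a + b) / 2 * ((a + b + 1) / 2) := by
  wlog h : a ≤ b generalizing a b
  · simpa [mul_comm, add_comm] using this b a (by omega)
  obtain ⟨p, hp⟩ : ∃ p, (a + b) / 2 = a + p := ⟨(a + b) / 2 - a, by omega⟩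
  obtain ⟨q, hq⟩ : ∃ q, (a + b + 1) / 2 = a + q := ⟨(a + b + 1) / 2 - a, by omega⟩
  have hb : b = a + p + q := by omega
  rw [hp, hq, hb]
  nlinarith [Nat.zero_le (p * q)]

lemma wmcut_cycleW (m : ℕ) : wmcut (cycleW (m + 3)) =
    ((m + 3 : ℕ) : ℝ) / ((m + 3) / 2 * ((m + 3 + 1) / 2) : ℕ) := by
  have lower : ∀ A : Finset (Fin (m + 3)), A.Nonempty → Aᶜ.Nonempty →
      ((m + 3 : ℕ) : ℝ) / ((m + 3) / 2 * ((m + 3 + 1) / 2) : ℕ) ≤ wncut (cycleW (m + 3)) A := by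
    intro A hA hA'
    rw [wncut_cycleW hA hA']
    have hcard : m + 3 = #A + #Aᶜ := by simp
    have hle : #A * #Aᶜ ≤ (m + 3) / 2 * ((m + 3 + 1) / 2) := by
      conv_rhs => rw [hcard]
      exact mul_le_half_mul_half _ _
    have hpos : 0 < #A * #Aᶜ := Nat.mul_pos hA.card_pos hA'.card_pos
    calc _ ≤ ((m + 3 : ℕ) : ℝ) / (#A * #Aᶜ : ℕ) := by gcongr
      _ ≤ _ := le_mul_of_one_le_left (by positivity)
        (by linarith [two_le_wcut_cycleW hA hA'])
  refine IsLeast.csInf_eq ⟨?_, ?_⟩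
  · set k : Fin (m + 3) := ⟨(m + 3) / 2, by omega⟩ with hk
    have hcard : #(Iio k) = (m + 3) / 2 := by simp [hk]
    have hcard' : #(Iio k)ᶜ = (m + 3 + 1) / 2 := by
      rw [card_compl, hcard, Fintype.card_fin]; omega
    have hA : (Iio k).Nonempty := card_pos.mp (by omega)
    have hA' : (Iio k)ᶜ.Nonempty := card_pos.mp (by omega)
    refine ⟨Iio k, hA, hA', ?_⟩
    rw [wncut_cycleW hA hA', hcard, hcard',
      le_antisymm (wcut_cycleW_Iio_le m k) (two_le_wcut_cycleW hA hA')]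
    simp
  · rintro x ⟨A, hA, hA', rfl⟩
    exact lower A hA hA'

/-- For the cycle `C_n` (n ≥ 3): `Mcut(C_n) = 4/n` if `n` is even,
`Mcut(C_n) = 4n/(n²−1)` if `n` is odd; equivalently `Mcut(C_n) = n/(⌊n/2⌋·⌈n/2⌉)`. -/
theorem mcut_cycle (n : ℕ) (hn : 3 ≤ n) :
    (Even n → wmcut (cycleW n) = 4 / n) ∧
    (Odd n → wmcut (cycleW n) = 4 * n / ((n : ℝ) ^ 2 - 1)) ∧
    wmcut (cycleW n) = (n : ℝ) / (((n / 2 : ℕ) : ℝ) * (((n + 1) / 2 : ℕ) : ℝ)) := by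
  have main : wmcut (cycleW n) = (n : ℝ) / (((n / 2 : ℕ) : ℝ) * (((n + 1) / 2 : ℕ) : ℝ)) := by
    obtain ⟨m, rfl⟩ := Nat.exists_eq_add_of_le' hn
    rw [wmcut_cycleW, Nat.cast_mul]
  refine ⟨?_, ?_, main⟩
  · rintro ⟨k, rfl⟩
    have hk : (k : ℝ) ≠ 0 := by exact_mod_cast (by omega : k ≠ 0)
    rw [main, show (k + k) / 2 = k by omega, show (k + k + 1) / 2 = k by omega]
    push_cast
    field_simp
    ring
  · rintro ⟨k, rfl⟩
    have hk : (k : ℝ) ≠ 0 := by exact_mod_cast (by omega : k ≠ 0)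
    have hk' : (k : ℝ) + 1 ≠ 0 := by positivity
    rw [main, show (2 * k + 1) / 2 = k by omega, show (2 * k + 1 + 1) / 2 = k + 1 by omega]
    push_cast
    rw [show (2 * (k : ℝ) + 1) ^ 2 - 1 = 4 * (k * (k + 1)) by ring]
    field_simp
end

section
/- For the path graph P_n with n ≥ 2, Mcut(P_n) = 2/(n − 1) if n is even and Mcut(P_n) = 2(n − 1)/(n(n − 2)) if n is odd; equivalently, Mcut(P_n) = (2n − 2)/(4⌊n/2⌋⌈n/2⌉ − 2n + 1). -/
open Finset

/-- The weight (adjacency) matrix of the unweighted path graph `P_n` on vertices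
`0, 1, ..., n-1`, with edges between consecutive vertices. -/
noncomputable def pathW (n : ℕ) : Matrix (Fin n) (Fin n) ℝ :=
  Matrix.of fun i j => if i.val + 1 = j.val ∨ j.val + 1 = i.val then 1 else 0

theorem pathW_apply (n : ℕ) (i j : Fin n) :
    pathW n i j = ((if i.val + 1 = j.val then 1 else 0 : ℕ) : ℝ)
      + ((if j.val + 1 = i.val then 1 else 0 : ℕ) : ℝ) := by
  simp only [pathW, Matrix.of_apply]
  split_ifs <;> first | omega | simp

theorem pathW_nonneg (n : ℕ) (i j : Fin n) : 0 ≤ pathW n i j := by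
  rw [pathW_apply]
  positivity

theorem wvol_eq_wcut_add {V : Type} [Fintype V] [DecidableEq V] (W : Matrix V V ℝ)
    (A : Finset V) : wvol W A = wcut W A + ∑ i ∈ A, ∑ j ∈ A, W i j := by
  simp only [wvol, wcut, wdeg]
  rw [← Finset.sum_add_distrib]
  exact Finset.sum_congr rfl fun i _ => (Finset.sum_compl_add_sum A (W i)).symm

theorem exists_wcut_pathW_eq_natCast (n : ℕ) (A : Finset (Fin n)) :
    ∃ c : ℕ, wcut (pathW n) A = c := by
  refine ⟨∑ i ∈ A, ∑ j ∈ Aᶜ, ((if i.val + 1 = j.val then 1 else 0)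
    + (if j.val + 1 = i.val then 1 else 0)), ?_⟩
  simp only [wcut, pathW_apply]
  push_cast
  rfl

/-- The volume of a vertex set of the path exceeds its cut by twice the number of inner edges. -/
theorem exists_wvol_pathW_eq (n : ℕ) (A : Finset (Fin n)) :
    ∃ e : ℕ, wvol (pathW n) A = wcut (pathW n) A + 2 * e := by
  refine ⟨∑ i ∈ A, ∑ j ∈ A, if i.val + 1 = j.val then 1 else 0, ?_⟩
  rw [wvol_eq_wcut_add]
  simp only [pathW_apply, Finset.sum_add_distrib]
  rw [Finset.sum_comm (f := fun i j : Fin n => ((if j.val + 1 = i.val then 1 else 0 : ℕ) : ℝ))]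
  push_cast
  ring

theorem wcut_pathW_compl (n : ℕ) (A : Finset (Fin n)) :
    wcut (pathW n) Aᶜ = wcut (pathW n) A := by
  simp only [wcut, compl_compl, pathW_apply]
  rw [Finset.sum_comm]
  simp only [add_comm]

theorem exists_pathW_crossing (n : ℕ) (A : Finset (Fin n)) (hA : A.Nonempty)
    (hB : Aᶜ.Nonempty) : ∃ i ∈ A, ∃ j ∈ Aᶜ, pathW n i j = 1 := by
  by_contra! h
  have step : ∀ k (hk : k + 1 < n), (⟨k, by omega⟩ : Fin n) ∈ A ↔ (⟨k + 1, hk⟩ : Fin n) ∈ A := by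
    intro k hk
    constructor
    · intro hm
      by_contra hc
      exact h _ hm _ (Finset.mem_compl.2 hc) (by simp [pathW])
    · intro hm
      by_contra hc
      exact h _ hm _ (Finset.mem_compl.2 hc) (by simp [pathW])
  have all : ∀ k (hk : k < n), (⟨k, hk⟩ : Fin n) ∈ A ↔ (⟨0, by omega⟩ : Fin n) ∈ A := by
    intro k
    induction k with
    | zero => intro hk; rfl
    | succ k ih => intro hk; rw [← step k hk, ih (by omega)]
  obtain ⟨i, hi⟩ := hA
  obtain ⟨j, hj⟩ := hB
  exact Finset.mem_compl.1 hj ((all j j.2).2 ((all i i.2).1 hi))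

theorem one_le_wcut_pathW (n : ℕ) (A : Finset (Fin n)) (hA : A.Nonempty)
    (hB : Aᶜ.Nonempty) : 1 ≤ wcut (pathW n) A := by
  obtain ⟨i, hi, j, hj, hij⟩ := exists_pathW_crossing n A hA hB
  calc (1 : ℝ) = pathW n i j := hij.symm
    _ ≤ ∑ j ∈ Aᶜ, pathW n i j :=
      Finset.single_le_sum (fun j _ => pathW_nonneg n i j) hj
    _ ≤ wcut (pathW n) A :=
      Finset.single_le_sum (f := fun i => ∑ j ∈ Aᶜ, pathW n i j)
        (fun i _ => Finset.sum_nonneg fun j _ => pathW_nonneg n i j) hi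

theorem wdeg_pathW (n : ℕ) (i : Fin n) :
    wdeg (pathW n) i = (if i.val + 1 < n then 1 else 0) + (if 0 < i.val then 1 else 0) := by
  simp only [wdeg, pathW_apply, Finset.sum_add_distrib]
  congr 1
  · split_ifs with h
    · rw [Finset.sum_eq_single (⟨i.val + 1, h⟩ : Fin n)]
      · simp
      · intro j _ hj
        have : i.val + 1 ≠ j.val := fun e => hj (Fin.ext e.symm)
        simp [this]
      · simp
    · refine Finset.sum_eq_zero fun j _ => ?_
      have : i.val + 1 ≠ j.val := by omega
      simp [this]
  · split_ifs with h
    · rw [Finset.sum_eq_single (⟨i.val - 1, by omega⟩ : Fin n)]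
      · have : i.val - 1 + 1 = i.val := by omega
        simp [this]
      · intro j _ hj
        have : j.val + 1 ≠ i.val := fun e => hj (Fin.ext (by simp only; omega))
        simp [this]
      · simp
    · refine Finset.sum_eq_zero fun j _ => ?_
      have : j.val + 1 ≠ i.val := by omega
      simp [this]

theorem sum_range_path_degree (n k : ℕ) (hk : 1 ≤ k) (hkn : k < n) :
    ∑ i ∈ Finset.range k, ((if i + 1 < n then 1 else 0) + (if 0 < i then 1 else 0) : ℝ)
      = 2 * k - 1 := by
  induction k, hk using Nat.le_induction with
  | base => simp [hkn]; norm_num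
  | succ k hk ih =>
    rw [Finset.sum_range_succ, ih (by omega), if_pos hkn, if_pos (by omega)]
    push_cast
    ring

theorem wvol_pathW_univ (n : ℕ) (hn : 2 ≤ n) :
    wvol (pathW n) Finset.univ = 2 * (n : ℝ) - 2 := by
  simp only [wvol, wdeg_pathW]
  rw [Fin.sum_univ_eq_sum_range
    (fun i => ((if i + 1 < n then 1 else 0) + (if 0 < i then 1 else 0) : ℝ))]
  obtain ⟨m, rfl⟩ : ∃ m, n = m + 1 := ⟨n - 1, by omega⟩
  rw [Finset.sum_range_succ, sum_range_path_degree _ m (by omega) (by omega),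
    if_neg (by omega), if_pos (by omega)]
  push_cast
  ring

theorem wvol_add_wvol_compl {V : Type} [Fintype V] [DecidableEq V] (W : Matrix V V ℝ)
    (A : Finset V) : wvol W A + wvol W Aᶜ = wvol W Finset.univ :=
  Finset.sum_add_sum_compl A (wdeg W)

theorem wvol_pathW_prefix (n k : ℕ) (hk : 1 ≤ k) (hkn : k < n) :
    wvol (pathW n) (Finset.univ.filter fun i : Fin n => i.val < k) = 2 * (k : ℝ) - 1 := by
  rw [← sum_range_path_degree n k hk hkn]
  simp only [wvol, wdeg_pathW]
  refine Finset.sum_bij (fun i _ => i.val) ?_ ?_ ?_ ?_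
  · intro i hi
    simpa using hi
  · intro i _ j _ h
    exact Fin.ext h
  · intro i hi
    have hi' := Finset.mem_range.1 hi
    exact ⟨⟨i, by omega⟩, by simpa using hi', rfl⟩
  · intro i _
    rfl

theorem wcut_pathW_prefix (n k : ℕ) (hk : 1 ≤ k) (hkn : k < n) :
    wcut (pathW n) (Finset.univ.filter fun i : Fin n => i.val < k) = 1 := by
  unfold wcut
  rw [Finset.sum_eq_single (⟨k - 1, by omega⟩ : Fin n),
    Finset.sum_eq_single (⟨k, hkn⟩ : Fin n)]
  · have : k - 1 + 1 = k := by omega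
    simp [pathW, this]
  · intro j hj hne
    have hj' : k ≤ j.val := by simpa using hj
    have : j.val ≠ k := fun e => hne (Fin.ext e)
    simp only [pathW, Matrix.of_apply]
    exact if_neg (by omega)
  · simp
  · intro i hi hne
    have hi' : i.val < k := by simpa using hi
    have : i.val ≠ k - 1 := fun e => hne (Fin.ext e)
    refine Finset.sum_eq_zero fun j hj => ?_
    have hj' : k ≤ j.val := by simpa using hj
    simp only [pathW, Matrix.of_apply]
    exact if_neg (by omega)
  · intro h
    exact absurd (by simp; omega) h

/-- The volumes of the two sides of a cut of the path satisfy `vol(A) · vol(V∖A) ≤ cut · D`, where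
`D` is the product of the volumes of the two sides of the balanced cut. -/
theorem mul_le_mul_balanced (n a b c e f : ℕ) (hn : 2 ≤ n) (hab : a + b = n) (hab' : a ≤ b)
    (hba : b ≤ a + 1) (hc : 1 ≤ c) (hsum : (c + 2 * e) + (c + 2 * f) = 2 * n - 2) :
    (((c : ℝ) + 2 * e) * (c + 2 * f)) ≤ c * (4 * a * b - 2 * n + 1) := by
  subst hab
  have hs : (c : ℝ) + e + f = a + b - 1 := by
    have : c + e + f + 1 = a + b := by omega
    have h : (c : ℝ) + e + f + 1 = a + b := by exact_mod_cast this
    linarith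
  have ha : (1 : ℝ) ≤ a := by exact_mod_cast (by omega : 1 ≤ a)
  push_cast
  obtain rfl | hc2 : c = 1 ∨ 2 ≤ c := by omega
  · have key : (e + 1) * (f + 1) ≤ a * b := by
      have h : e + f + 2 = a + b := by omega
      obtain h1 | h1 : e + 1 ≤ a ∨ b ≤ e + 1 := by omega
      · obtain ⟨d, rfl⟩ := Nat.exists_eq_add_of_le h1
        rw [show f + 1 = b + d by omega]
        nlinarith [Nat.mul_le_mul_left d (show e + 1 ≤ b by omega)]
      · obtain ⟨d, hd⟩ := Nat.exists_eq_add_of_le h1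
        obtain rfl : a = f + 1 + d := by omega
        rw [hd]
        nlinarith [Nat.mul_le_mul_left d (show f + 1 ≤ b by omega)]
    have key' : ((e : ℝ) + 1) * (f + 1) ≤ a * b := by exact_mod_cast key
    push_cast at hs ⊢
    nlinarith
  · have hc' : (2 : ℝ) ≤ c := by exact_mod_cast hc2
    have hxy : ((c : ℝ) + 2 * e) * (c + 2 * f) ≤ (a + b - 1) ^ 2 := by
      rw [← hs]
      nlinarith [sq_nonneg ((e : ℝ) - f)]
    obtain rfl | rfl : b = a ∨ b = a + 1 := by omega
    · nlinarith
    · push_cast at *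
      nlinarith

theorem wmcut_pathW (n : ℕ) (hn : 2 ≤ n) :
    wmcut (pathW n) =
      (2 * (n : ℝ) - 2) /
        (4 * ((n / 2 : ℕ) : ℝ) * (((n + 1) / 2 : ℕ) : ℝ) - 2 * (n : ℝ) + 1) := by
  obtain ⟨a, ha⟩ : ∃ a, a = n / 2 := ⟨_, rfl⟩
  obtain ⟨b, hb⟩ : ∃ b, b = (n + 1) / 2 := ⟨_, rfl⟩
  rw [← ha, ← hb]
  have hab : (a : ℝ) + b = n := by exact_mod_cast (by omega : a + b = n)
  have ha1 : (1 : ℝ) ≤ a := by exact_mod_cast (by omega : 1 ≤ a)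
  have hb1 : (1 : ℝ) ≤ b := by exact_mod_cast (by omega : 1 ≤ b)
  have hD : 4 * (a : ℝ) * b - 2 * n + 1 = (2 * a - 1) * (2 * b - 1) := by
    rw [← hab]
    ring
  have hx : (0 : ℝ) < 2 * a - 1 := by linarith
  have hy : (0 : ℝ) < 2 * b - 1 := by linarith
  refine IsLeast.csInf_eq ⟨?_, ?_⟩
  · refine ⟨Finset.univ.filter fun i : Fin n => i.val < a, ⟨⟨0, by omega⟩, by simp; omega⟩,
      ⟨⟨a, by omega⟩, by simp⟩, ?_⟩
    have hv := wvol_pathW_prefix n a (by omega) (by omega)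
    have hw := wvol_add_wvol_compl (pathW n) (Finset.univ.filter fun i : Fin n => i.val < a)
    rw [hv, wvol_pathW_univ n hn] at hw
    have hw' : wvol (pathW n) (Finset.univ.filter fun i : Fin n => i.val < a)ᶜ = 2 * b - 1 := by
      linarith
    rw [wncut, wcut_pathW_prefix n a (by omega) (by omega), hv, hw', hD, ← hab]
    field_simp
    ring
  · rintro _ ⟨A, hA, hB, rfl⟩
    obtain ⟨c, hc⟩ := exists_wcut_pathW_eq_natCast n A
    obtain ⟨e, he⟩ := exists_wvol_pathW_eq n A
    obtain ⟨f, hf⟩ := exists_wvol_pathW_eq n Aᶜ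
    have hsymm := wcut_pathW_compl n A
    have hc1 := one_le_wcut_pathW n A hA hB
    have hsum := wvol_add_wvol_compl (pathW n) A
    rw [hsymm] at hf
    rw [hc] at he hf hc1
    rw [he, hf, wvol_pathW_univ n hn] at hsum
    have hsum' : (c + 2 * e) + (c + 2 * f) = 2 * n - 2 := by
      have : (c + 2 * e) + (c + 2 * f) + 2 = 2 * n := by
        have h : ((c : ℝ) + 2 * e) + (c + 2 * f) + 2 = 2 * n := by linarith
        exact_mod_cast h
      omega
    have hle := mul_le_mul_balanced n a b c e f hn (by omega) (by omega) (by omega)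
      (by exact_mod_cast hc1) hsum'
    have hx' : (0 : ℝ) < c + 2 * e := by positivity
    have hy' : (0 : ℝ) < c + 2 * f := by positivity
    have hval : wncut (pathW n) A
        = c * (2 * (n : ℝ) - 2) / ((c + 2 * e) * (c + 2 * f)) := by
      rw [wncut, hc, he, hf, ← hsum]
      field_simp
      ring
    have hn' : (0 : ℝ) ≤ 2 * n - 2 := by linarith
    rw [hval, div_le_div_iff₀ (by rw [hD]; positivity) (by positivity)]
    nlinarith [mul_le_mul_of_nonneg_left hle hn']

/-- For the path `P_n` (n ≥ 2): `Mcut(P_n) = 2/(n−1)` if `n` is even,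
`Mcut(P_n) = 2(n−1)/(n(n−2))` if `n` is odd; equivalently
`Mcut(P_n) = (2n−2)/(4⌊n/2⌋⌈n/2⌉ − 2n + 1)`. -/
theorem mcut_path (n : ℕ) (hn : 2 ≤ n) :
    (Even n → wmcut (pathW n) = 2 / ((n : ℝ) - 1)) ∧
    (Odd n → wmcut (pathW n) = 2 * ((n : ℝ) - 1) / ((n : ℝ) * ((n : ℝ) - 2))) ∧
    wmcut (pathW n) =
      (2 * (n : ℝ) - 2) /
        (4 * ((n / 2 : ℕ) : ℝ) * (((n + 1) / 2 : ℕ) : ℝ) - 2 * (n : ℝ) + 1) := by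
  have h := wmcut_pathW n hn
  refine ⟨?_, ?_, h⟩
  · rintro ⟨m, rfl⟩
    have hm : (1 : ℝ) ≤ m := by exact_mod_cast (by omega : 1 ≤ m)
    rw [h, show (m + m) / 2 = m by omega, show (m + m + 1) / 2 = m by omega]
    push_cast
    rw [show 4 * (m : ℝ) * m - 2 * (m + m) + 1 = (m + m - 1) * (m + m - 1) by ring,
      show 2 * ((m : ℝ) + m) - 2 = 2 * (m + m - 1) by ring]
    exact mul_div_mul_right _ _ (by linarith)
  · rintro ⟨m, rfl⟩
    rw [h, show (2 * m + 1) / 2 = m by omega, show (2 * m + 1 + 1) / 2 = m + 1 by omega]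
    push_cast
    congr 1 <;> ring
end

section
/- For the lollipop graph LP_{n,m} with n ≥ 3 and m ≥ 1, Mcut(LP_{n,m}) equals: (n² − n + 2m)/((2m − 1)(n² − n + 1)) if 2 ≤ m ≤ (n² − n + 4)/2; 4/(n² − n + 2m) if m > (n² − n + 4)/2 and (n² − n + 2m + 2)/4 is an integer; 4(n² − n + 2m)/((n(n−1) + 2(m−1))·(n(n−1) + 2(m+1))) if m > (n² − n + 4)/2 and (n² − n + 2m + 2)/4 is not an integer; and (n² − n + 2)/((n+1)(n−1)) if m = 1. -/
open Finset

/-- The weight (adjacency) matrix of the lollipop graph `LP_{n,m}`: a path on the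
vertices `Sum.inl i` (`x_1, ..., x_m`), a complete graph on the vertices `Sum.inr j`
(`y_1, ..., y_n`), and an edge joining the path end `x_m` with `y_1`. -/
noncomputable def lollipopW (n m : ℕ) :
    Matrix (Fin m ⊕ Fin n) (Fin m ⊕ Fin n) ℝ :=
  Matrix.of fun p q =>
    match p, q with
    | Sum.inl i, Sum.inl j => if i.val + 1 = j.val ∨ j.val + 1 = i.val then 1 else 0
    | Sum.inl i, Sum.inr j => if i.val = m - 1 ∧ j.val = 0 then 1 else 0
    | Sum.inr i, Sum.inl j => if j.val = m - 1 ∧ i.val = 0 then 1 else 0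
    | Sum.inr i, Sum.inr j => if i ≠ j then 1 else 0

/-- The adjacency matrix of the lollipop graph with natural number entries. -/
def lollipopNat (n m : ℕ) : Fin m ⊕ Fin n → Fin m ⊕ Fin n → ℕ
  | Sum.inl i, Sum.inl j => if i.val + 1 = j.val ∨ j.val + 1 = i.val then 1 else 0
  | Sum.inl i, Sum.inr j => if i.val = m - 1 ∧ j.val = 0 then 1 else 0
  | Sum.inr i, Sum.inl j => if j.val = m - 1 ∧ i.val = 0 then 1 else 0
  | Sum.inr i, Sum.inr j => if i ≠ j then 1 else 0

theorem lollipopW_eq_cast (n m : ℕ) (p q : Fin m ⊕ Fin n) :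
    lollipopW n m p q = (lollipopNat n m p q : ℝ) := by
  rcases p with i | i <;> rcases q with j | j <;> simp [lollipopW, lollipopNat]

theorem lollipopNat_comm (n m : ℕ) (p q : Fin m ⊕ Fin n) :
    lollipopNat n m p q = lollipopNat n m q p := by
  rcases p with i | i <;> rcases q with j | j <;>
    simp [lollipopNat, or_comm, eq_comm]

theorem lollipopNat_self (n m : ℕ) (p : Fin m ⊕ Fin n) : lollipopNat n m p p = 0 := by
  rcases p with i | i <;> simp [lollipopNat]

/-- The number of edges leaving `A`. -/
def lollipopCut (n m : ℕ) (A : Finset (Fin m ⊕ Fin n)) : ℕ :=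
  ∑ p ∈ A, ∑ q ∈ Aᶜ, lollipopNat n m p q

/-- The sum of the degrees of the vertices of `A`. -/
def lollipopVol (n m : ℕ) (A : Finset (Fin m ⊕ Fin n)) : ℕ :=
  ∑ p ∈ A, ∑ q, lollipopNat n m p q

theorem wcut_lollipopW (n m : ℕ) (A : Finset (Fin m ⊕ Fin n)) :
    wcut (lollipopW n m) A = lollipopCut n m A := by
  simp [wcut, lollipopCut, lollipopW_eq_cast]

theorem wvol_lollipopW (n m : ℕ) (A : Finset (Fin m ⊕ Fin n)) :
    wvol (lollipopW n m) A = lollipopVol n m A := by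
  simp [wvol, wdeg, lollipopVol, lollipopW_eq_cast, -Fintype.sum_sum_type]

theorem lollipopCut_compl (n m : ℕ) (A : Finset (Fin m ⊕ Fin n)) :
    lollipopCut n m Aᶜ = lollipopCut n m A := by
  rw [lollipopCut, lollipopCut, Finset.sum_comm, compl_compl]
  exact Finset.sum_congr rfl fun p _ => Finset.sum_congr rfl fun q _ => lollipopNat_comm n m q p

theorem even_sum_sum_of_symm {V : Type*} (f : V → V → ℕ)
    (hf : ∀ p q, f p q = f q p) (hf' : ∀ p, f p p = 0) (A : Finset V) :
    Even (∑ p ∈ A, ∑ q ∈ A, f p q) := by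
  classical
  induction A using Finset.induction_on with
  | empty => simp
  | insert a A ha ih =>
    have h : ∑ p ∈ A, f p a = ∑ q ∈ A, f a q := Finset.sum_congr rfl fun p _ => hf p a
    simp only [Finset.sum_insert ha, Finset.sum_add_distrib, hf', h]
    obtain ⟨r, hr⟩ := ih
    exact ⟨∑ q ∈ A, f a q + r, by omega⟩

theorem exists_lollipopVol_eq (n m : ℕ) (A : Finset (Fin m ⊕ Fin n)) :
    ∃ k, lollipopVol n m A = lollipopCut n m A + 2 * k := by
  obtain ⟨r, hr⟩ := even_sum_sum_of_symm (lollipopNat n m) (lollipopNat_comm n m)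
    (lollipopNat_self n m) A
  refine ⟨r, ?_⟩
  have h : lollipopVol n m A =
      ∑ p ∈ A, ∑ q ∈ A, lollipopNat n m p q + lollipopCut n m A := by
    rw [lollipopVol, lollipopCut, ← Finset.sum_add_distrib]
    exact Finset.sum_congr rfl fun p _ => (Finset.sum_add_sum_compl A _).symm
  omega

theorem one_le_lollipopCut {n m : ℕ} (hn : 1 ≤ n) (hm : 1 ≤ m) {A : Finset (Fin m ⊕ Fin n)}
    (hA : A.Nonempty) (hA' : Aᶜ.Nonempty) : 1 ≤ lollipopCut n m A := by
  by_contra! hlt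
  have h0 : ∀ p ∈ A, ∀ q ∈ Aᶜ, lollipopNat n m p q = 0 := by
    have : lollipopCut n m A = 0 := by omega
    simpa only [lollipopCut, Finset.sum_eq_zero_iff] using this
  have key : ∀ p q, lollipopNat n m p q = 1 → (p ∈ A ↔ q ∈ A) := by
    intro p q h
    constructor
    · intro hp
      by_contra hq
      have := h0 p hp q (Finset.mem_compl.2 hq)
      omega
    · intro hq
      by_contra hp
      have := h0 q hq p (Finset.mem_compl.2 hp)
      rw [lollipopNat_comm] at this
      omega
  have hy : ∀ j : Fin n, Sum.inr j ∈ A ↔ Sum.inr ⟨0, hn⟩ ∈ A := by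
    intro j
    by_cases hj : j = ⟨0, hn⟩
    · rw [hj]
    · exact key _ _ (by simp [lollipopNat, hj])
  have hx : ∀ i (hi : i < m), Sum.inl ⟨i, hi⟩ ∈ A ↔ Sum.inl ⟨0, hm⟩ ∈ A := by
    intro i
    induction i with
    | zero => simp
    | succ i ih =>
      intro hi
      rw [← ih (by omega)]
      exact key _ _ (by simp [lollipopNat])
  have hxy : Sum.inl ⟨m - 1, by omega⟩ ∈ A ↔ Sum.inr ⟨0, hn⟩ ∈ A :=
    key _ _ (by simp [lollipopNat])
  have hall : ∀ p, p ∈ A ↔ Sum.inr ⟨0, hn⟩ ∈ A := by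
    rintro (⟨i, hi⟩ | j)
    · rw [hx, ← hxy, hx (m - 1)]
    · exact hy j
  obtain ⟨p, hp⟩ := hA
  obtain ⟨q, hq⟩ := hA'
  rw [Finset.mem_compl] at hq
  exact hq ((hall q).2 ((hall p).1 hp))

theorem sum_ite_eq_val (m c : ℕ) :
    ∑ j : Fin m, (if c = j.val then 1 else 0) = if c < m then 1 else 0 := by
  split_ifs with h
  · rw [Finset.sum_eq_single ⟨c, h⟩] <;> simp +contextual [Fin.ext_iff, eq_comm]
  · exact Finset.sum_eq_zero fun j _ => if_neg (by omega)

theorem sum_lollipopNat_inl {n m : ℕ} (hn : 1 ≤ n) (i : Fin m) :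
    ∑ q, lollipopNat n m (Sum.inl i) q + (if 0 = i.val then 1 else 0) = 2 := by
  have h1 : ∑ j : Fin m, lollipopNat n m (Sum.inl i) (Sum.inl j) =
      (if i.val + 1 < m then 1 else 0) + if 0 < i.val then 1 else 0 := by
    rw [← sum_ite_eq_val]
    have : (if 0 < i.val then 1 else 0) =
        ∑ j : Fin m, if 0 < i.val ∧ i.val - 1 = j.val then 1 else 0 := by
      split_ifs with h
      · simp only [h, true_and, sum_ite_eq_val]
        rw [if_pos (by omega)]
      · simp [h]
    rw [this, ← Finset.sum_add_distrib]
    refine Finset.sum_congr rfl fun j _ => ?_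
    simp only [lollipopNat]
    split_ifs <;> omega
  have h2 : ∑ j : Fin n, lollipopNat n m (Sum.inl i) (Sum.inr j) =
      if i.val = m - 1 then 1 else 0 := by
    simp only [lollipopNat]
    split_ifs with h
    · simp only [h, true_and, eq_comm (b := 0), sum_ite_eq_val]
      rw [if_pos (by omega)]
    · simp [h]
  rw [Fintype.sum_sum_type, h1, h2]
  have := i.isLt
  split_ifs <;> omega

theorem sum_lollipopNat_inr {n m : ℕ} (hm : 1 ≤ m) (j : Fin n) :
    ∑ q, lollipopNat n m (Sum.inr j) q = (n - 1) + if 0 = j.val then 1 else 0 := by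
  have h1 : ∑ i : Fin m, lollipopNat n m (Sum.inr j) (Sum.inl i) =
      if 0 = j.val then 1 else 0 := by
    simp only [lollipopNat]
    split_ifs with h
    · simp only [← h, and_true, eq_comm (b := m - 1), sum_ite_eq_val]
      rw [if_pos (by omega)]
    · simp [Ne.symm h]
  have h2 : ∑ i : Fin n, lollipopNat n m (Sum.inr j) (Sum.inr i) = n - 1 := by
    simp only [lollipopNat, Finset.sum_boole]
    rw [Finset.filter_ne, Finset.card_erase_of_mem (Finset.mem_univ j)]
    simp
  rw [Fintype.sum_sum_type, h1, h2, add_comm]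

theorem compl_disjSum {α β : Type*} [Fintype α] [Fintype β] [DecidableEq α] [DecidableEq β]
    (S : Finset α) (T : Finset β) : (S.disjSum T)ᶜ = Sᶜ.disjSum Tᶜ := by
  ext (x | x) <;> simp

/-- The sum of the degrees of a set of path vertices of the lollipop graph. -/
def pathVol {m : ℕ} (S : Finset (Fin m)) : ℕ :=
  ∑ i ∈ S, (2 - if 0 = i.val then 1 else 0)

theorem pathVol_add {m : ℕ} (S : Finset (Fin m)) :
    pathVol S + ∑ i ∈ S, (if 0 = i.val then 1 else 0) = 2 * S.card := by
  rw [pathVol, ← Finset.sum_add_distrib, mul_comm, ← smul_eq_mul, ← Finset.sum_const]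
  exact Finset.sum_congr rfl fun i _ => by split_ifs <;> rfl

theorem pathVol_add_compl {m : ℕ} (hm : 1 ≤ m) (S : Finset (Fin m)) :
    pathVol S + pathVol Sᶜ = 2 * m - 1 := by
  have h := pathVol_add (Finset.univ : Finset (Fin m))
  rw [sum_ite_eq_val, if_pos (by omega), Finset.card_univ, Fintype.card_fin] at h
  have h' : pathVol S + pathVol Sᶜ = pathVol (Finset.univ : Finset (Fin m)) :=
    Finset.sum_add_sum_compl S _
  omega

theorem lollipopVol_disjSum {n m : ℕ} (hn : 1 ≤ n) (hm : 1 ≤ m) (S : Finset (Fin m))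
    (T : Finset (Fin n)) :
    lollipopVol n m (S.disjSum T) =
      pathVol S + T.card * (n - 1) + ∑ j ∈ T, if 0 = j.val then 1 else 0 := by
  rw [lollipopVol, Finset.sum_disjSum, add_assoc]
  congr 1
  · exact Finset.sum_congr rfl fun i _ => Nat.eq_sub_of_add_eq (sum_lollipopNat_inl hn i)
  · simp only [sum_lollipopNat_inr hm, Finset.sum_add_distrib, Finset.sum_const, smul_eq_mul]

theorem lollipopCut_disjSum (n m : ℕ) (S : Finset (Fin m)) (T : Finset (Fin n)) :
    lollipopCut n m (S.disjSum T) =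
      (∑ i ∈ S, (∑ i' ∈ Sᶜ, lollipopNat n m (Sum.inl i) (Sum.inl i') +
        ∑ j ∈ Tᶜ, lollipopNat n m (Sum.inl i) (Sum.inr j))) +
      (∑ j ∈ T, ∑ i ∈ Sᶜ, lollipopNat n m (Sum.inr j) (Sum.inl i) + T.card * Tᶜ.card) := by
  have h : T.card * Tᶜ.card = ∑ j ∈ T, ∑ j' ∈ Tᶜ, lollipopNat n m (Sum.inr j) (Sum.inr j') := by
    rw [Finset.card_eq_sum_ones, Finset.sum_mul]
    refine Finset.sum_congr rfl fun j hj => ?_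
    rw [one_mul, Finset.card_eq_sum_ones]
    refine Finset.sum_congr rfl fun j' hj' => (if_pos ?_).symm
    rintro rfl
    exact Finset.mem_compl.1 hj' hj
  rw [lollipopCut, compl_disjSum, Finset.sum_disjSum, h, ← Finset.sum_add_distrib]
  simp only [Finset.sum_disjSum]

theorem exists_lollipop_data {n m : ℕ} (hn : 1 ≤ n) (hm : 1 ≤ m) {A : Finset (Fin m ⊕ Fin n)}
    (hA : A.Nonempty) (hA' : Aᶜ.Nonempty) :
    ∃ k l s s' j j' t t' : ℕ, 1 ≤ lollipopCut n m A ∧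
      lollipopVol n m A = lollipopCut n m A + 2 * k ∧
      lollipopVol n m Aᶜ = lollipopCut n m A + 2 * l ∧
      lollipopVol n m A = s + j * (n - 1) + t ∧
      lollipopVol n m Aᶜ = s' + j' * (n - 1) + t' ∧
      s + s' = 2 * m - 1 ∧ j + j' = n ∧ t + t' = 1 ∧ j * j' ≤ lollipopCut n m A ∧
      (j = 0 → t = 0) ∧ (j' = 0 → t' = 0) := by
  obtain ⟨k, hk⟩ := exists_lollipopVol_eq n m A
  obtain ⟨l, hl⟩ := exists_lollipopVol_eq n m Aᶜ
  rw [lollipopCut_compl] at hl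
  have hdis : A = A.toLeft.disjSum A.toRight := Finset.toLeft_disjSum_toRight.symm
  have hcut := lollipopCut_disjSum n m A.toLeft A.toRight
  have hvol := lollipopVol_disjSum hn hm A.toLeft A.toRight
  have hvol' := lollipopVol_disjSum hn hm A.toLeftᶜ A.toRightᶜ
  rw [← compl_disjSum, ← hdis] at hvol'
  rw [← hdis] at hcut hvol
  refine ⟨k, l, _, _, _, _, _, _, one_le_lollipopCut hn hm hA hA', hk, hl, hvol, hvol',
    pathVol_add_compl hm _, by simp, ?_, by omega, fun h => ?_, fun h => ?_⟩
  · rw [Finset.sum_add_sum_compl, sum_ite_eq_val, if_pos (by omega)]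
  · rw [Finset.card_eq_zero.1 h, Finset.sum_empty]
  · rw [Finset.card_eq_zero.1 h, Finset.sum_empty]

theorem lollipopVol_add_compl {n m : ℕ} (hn : 1 ≤ n) (hm : 1 ≤ m) (A : Finset (Fin m ⊕ Fin n)) :
    lollipopVol n m A + lollipopVol n m Aᶜ = n * (n - 1) + 2 * m := by
  have h : lollipopVol n m A + lollipopVol n m Aᶜ = lollipopVol n m Finset.univ :=
    Finset.sum_add_sum_compl A _
  have hu : (Finset.univ : Finset (Fin m ⊕ Fin n)) = Finset.univ.disjSum Finset.univ :=
    Finset.univ_disjSum_univ.symm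
  have h' := pathVol_add_compl hm Finset.univ
  rw [Finset.compl_univ, show pathVol (∅ : Finset (Fin m)) = 0 from Finset.sum_empty] at h'
  rw [h, hu, lollipopVol_disjSum hn hm, sum_ite_eq_val, if_pos (by omega), Finset.card_univ,
    Fintype.card_fin]
  omega

/-- The set of the first `k` path vertices of the lollipop graph. -/
def pathPrefix (n m k : ℕ) : Finset (Fin m ⊕ Fin n) :=
  (Finset.univ.filter fun i : Fin m => i.val < k).disjSum ∅

theorem lollipopVol_pathPrefix {n m k : ℕ} (hn : 1 ≤ n) (hk : 1 ≤ k) (hkm : k ≤ m) :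
    lollipopVol n m (pathPrefix n m k) = 2 * k - 1 := by
  have h := pathVol_add (Finset.univ.filter fun i : Fin m => i.val < k)
  have hs : ∑ i ∈ Finset.univ.filter (fun i : Fin m => i.val < k),
      (if 0 = i.val then 1 else 0) = 1 := by
    have h0 := sum_ite_eq_val m 0
    rw [if_pos (by omega)] at h0
    rw [Finset.sum_filter, ← h0]
    exact Finset.sum_congr rfl fun i _ => by split_ifs <;> omega
  rw [hs, Fin.card_filter_val_lt] at h
  rw [pathPrefix, lollipopVol_disjSum hn (by omega), Finset.card_empty, Finset.sum_empty]
  omega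

theorem lollipopCut_pathPrefix {n m k : ℕ} (hn : 1 ≤ n) (hk : 1 ≤ k) (hkm : k ≤ m) :
    lollipopCut n m (pathPrefix n m k) = 1 := by
  rw [pathPrefix, lollipopCut_disjSum, Finset.sum_empty, Finset.card_empty, zero_mul, add_zero,
    add_zero, Finset.sum_eq_single ⟨k - 1, by omega⟩]
  · have h1 : ∑ j ∈ (∅ : Finset (Fin n))ᶜ,
        lollipopNat n m (Sum.inl ⟨k - 1, by omega⟩) (Sum.inr j) = if k = m then 1 else 0 := by
      simp only [Finset.compl_empty, lollipopNat]
      split_ifs with h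
      · simp only [h, true_and, eq_comm (b := 0), sum_ite_eq_val]
        rw [if_pos (by omega)]
      · exact Finset.sum_eq_zero fun j _ => if_neg (by omega)
    have h2 : ∑ i ∈ (Finset.univ.filter fun i : Fin m => i.val < k)ᶜ,
        lollipopNat n m (Sum.inl ⟨k - 1, by omega⟩) (Sum.inl i) = if k < m then 1 else 0 := by
      rw [← sum_ite_eq_val, Finset.compl_filter, Finset.sum_filter]
      refine Finset.sum_congr rfl fun i _ => ?_
      simp only [lollipopNat]
      split_ifs <;> omega
    rw [h1, h2]
    split_ifs <;> omega
  · intro i hi hne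
    have hi' : i.val < k := by simpa using hi
    have hne' : i.val ≠ k - 1 := fun h => hne (Fin.ext h)
    rw [Finset.sum_eq_zero, Finset.sum_eq_zero, add_zero]
    · intro j _
      exact if_neg (by omega)
    · intro i' hi''
      have : ¬ i'.val < k := by simpa using hi''
      exact if_neg (by omega)
  · intro h
    exact absurd (Finset.mem_filter.2 ⟨Finset.mem_univ _, by simp; omega⟩) h

theorem wmcut_eq_div {n m M : ℕ} (hn : 1 ≤ n) (hm : 1 ≤ m)
    (hle : ∀ A : Finset (Fin m ⊕ Fin n), A.Nonempty → Aᶜ.Nonempty →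
      lollipopVol n m A * lollipopVol n m Aᶜ ≤ lollipopCut n m A * M)
    (hM : ∃ A : Finset (Fin m ⊕ Fin n), A.Nonempty ∧ Aᶜ.Nonempty ∧
      lollipopVol n m A * lollipopVol n m Aᶜ = lollipopCut n m A * M) :
    wmcut (lollipopW n m) = ((n * (n - 1) + 2 * m : ℕ) : ℝ) / M := by
  have pos : ∀ A : Finset (Fin m ⊕ Fin n), A.Nonempty → Aᶜ.Nonempty →
      (0 : ℝ) < lollipopVol n m A ∧ (0 : ℝ) < lollipopVol n m Aᶜ ∧ (0 : ℝ) < M ∧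
      (0 : ℝ) < lollipopCut n m A ∧
      wncut (lollipopW n m) A = lollipopCut n m A * ((n * (n - 1) + 2 * m : ℕ) : ℝ) /
        ((lollipopVol n m A : ℝ) * lollipopVol n m Aᶜ) := by
    intro A hA hA'
    obtain ⟨k, l, -, -, -, -, -, -, hc, hk, hl, -⟩ := exists_lollipop_data hn hm hA hA'
    have ha : 0 < lollipopVol n m A := by omega
    have hb : 0 < lollipopVol n m Aᶜ := by omega
    have hM0 : 0 < M := Nat.pos_of_ne_zero fun h => by
      have := hle A hA hA'
      rw [h, mul_zero] at this
      have := Nat.mul_pos ha hb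
      omega
    have ha' : (0 : ℝ) < lollipopVol n m A := by exact_mod_cast ha
    have hb' : (0 : ℝ) < lollipopVol n m Aᶜ := by exact_mod_cast hb
    refine ⟨ha', hb', by exact_mod_cast hM0, by exact_mod_cast hc, ?_⟩
    rw [wncut, wcut_lollipopW, wvol_lollipopW, wvol_lollipopW,
      ← lollipopVol_add_compl hn hm A]
    push_cast
    field_simp
    ring
  refine IsLeast.csInf_eq ⟨?_, ?_⟩
  · obtain ⟨A, hA, hA', h⟩ := hM
    obtain ⟨ha, hb, hM0, hc, heq⟩ := pos A hA hA'
    refine ⟨A, hA, hA', ?_⟩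
    have h' : (lollipopVol n m A : ℝ) * lollipopVol n m Aᶜ = lollipopCut n m A * M := by
      exact_mod_cast h
    rw [heq, h']
    field_simp
  · rintro _ ⟨A, hA, hA', rfl⟩
    obtain ⟨ha, hb, hM0, hc, heq⟩ := pos A hA hA'
    have h' : (lollipopVol n m A : ℝ) * lollipopVol n m Aᶜ ≤ lollipopCut n m A * M := by
      exact_mod_cast hle A hA hA'
    rw [heq, div_le_div_iff₀ hM0 (by positivity)]
    calc ((n * (n - 1) + 2 * m : ℕ) : ℝ) * ((lollipopVol n m A : ℝ) * lollipopVol n m Aᶜ)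
        ≤ ((n * (n - 1) + 2 * m : ℕ) : ℝ) * (lollipopCut n m A * M) := by gcongr
      _ = _ := by ring

theorem mul_le_of_le_left {a b c p q k s' : ℤ} (hp : p ≤ q + 2) (hp0 : 3 ≤ p) (hq : 1 ≤ q)
    (hqo : Odd q) (hc : 1 ≤ c) (hk : a = c + 2 * k) (hap : a + s' = p) (hs' : 0 ≤ s')
    (hab : a + b = p + q) : a * b ≤ c * (p * q) := by
  obtain ⟨w, hw⟩ := hqo
  have hid : p * q - a * b = s' * (q - a) := by
    rw [show b = p + q - a by linarith, ← hap]; ring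
  have hpq : 0 < p * q := by positivity
  have hge : p * q ≤ c * (p * q) := by nlinarith
  rcases le_or_gt a q with h | h
  · nlinarith [mul_nonneg hs' (sub_nonneg.2 h)]
  · have hs1 : s' = 0 ∨ s' = 1 := by omega
    rcases hs1 with rfl | rfl
    · linarith
    · have ha : a = q + 1 := by omega
      have hc2 : 2 ≤ c := by omega
      nlinarith

theorem mul_le_of_clique_split {r p j j' s s' t t' c : ℤ} (hr : 2 ≤ r) (hp0 : 3 ≤ p)
    (hp : p ≤ (r + 1) * r + 3) (hs : 0 ≤ s) (hs' : 0 ≤ s') (ht : 0 ≤ t) (ht' : 0 ≤ t')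
    (hss : s + s' = p) (hjj : j + j' = r + 1) (htt : t + t' = 1) (hj : 1 ≤ j) (hj' : 1 ≤ j')
    (hc : j * j' ≤ c) :
    (s + j * r + t) * (s' + j' * r + t') ≤ c * (p * ((r + 1) * r + 1)) := by
  have hjr : r ≤ j * j' := by nlinarith
  have hpq : 0 < p * ((r + 1) * r + 1) := by positivity
  rcases hr.eq_or_lt with rfl | hr
  · have hV : (s + j * 2 + t) + (s' + j' * 2 + t') = p + 7 := by linarith
    have h4 : 4 * ((s + j * 2 + t) * (s' + j' * 2 + t')) ≤ (p + 7) ^ 2 := by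
      rw [← hV]
      nlinarith [sq_nonneg ((s + j * 2 + t) - (s' + j' * 2 + t'))]
    nlinarith
  · have h1 : (s + j * r + t) * (s' + j' * r + t') ≤ (p + 1 + j * r) * (p + 1 + j' * r) := by
      have : 0 ≤ j' * r := by positivity
      have : 0 ≤ j * r := by positivity
      apply mul_le_mul <;> linarith
    have h2 : (p + 1 + j * r) * (p + 1 + j' * r) =
        (p + 1) * (p + 1 + (r + 1) * r) + j * j' * r ^ 2 := by
      rw [← hjj]; ring
    have h3 : (p + 1) * (p + 1 + (r + 1) * r) ≤ r * (p * ((r + 1) * r + 1) - r ^ 2) := by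
      obtain ⟨u, rfl⟩ : ∃ u, p = 3 + u := ⟨p - 3, by ring⟩
      have hu : 0 ≤ u := by linarith
      have hu2 : u * u ≤ u * ((r + 1) * r) := by nlinarith
      have hN : 4 * r ≤ (r + 1) * r := by nlinarith
      have hlin : 0 ≤ u * (r * ((r + 1) * r + 1) - 8 - 2 * ((r + 1) * r)) := by
        apply mul_nonneg hu
        nlinarith
      have hconst : 0 ≤ 2 * r ^ 3 - r ^ 2 - r - 16 := by
        nlinarith [mul_nonneg (by linarith : 0 ≤ r - 3) (sq_nonneg r)]
      nlinarith
    have h4 : 0 ≤ p * ((r + 1) * r + 1) - r ^ 2 := by nlinarith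
    have h5 := mul_le_mul_of_nonneg_right hjr h4
    have h6 := mul_le_mul_of_nonneg_right hc hpq.le
    nlinarith

theorem mul_le_of_le_quadratic {r p j j' s s' t t' a b c k l : ℤ} (hr : 2 ≤ r) (hp0 : 3 ≤ p)
    (hp : p ≤ (r + 1) * r + 3) (hs : 0 ≤ s) (hs' : 0 ≤ s') (ht : 0 ≤ t) (ht' : 0 ≤ t')
    (hj : 0 ≤ j) (hj' : 0 ≤ j') (hss : s + s' = p) (hjj : j + j' = r + 1) (htt : t + t' = 1)
    (hc : 1 ≤ c) (hjc : j * j' ≤ c) (hk : a = c + 2 * k) (hl : b = c + 2 * l)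
    (ha : a = s + j * r + t) (hb : b = s' + j' * r + t') (hj0 : j = 0 → t = 0)
    (hj0' : j' = 0 → t' = 0) : a * b ≤ c * (p * ((r + 1) * r + 1)) := by
  have hodd : Odd ((r + 1) * r + 1) := by
    rw [mul_comm]
    exact (Int.even_mul_succ_self r).add_one
  have hab : a + b = p + ((r + 1) * r + 1) := by rw [← hjj, ← hss, ha, hb]; linarith
  have hq : 1 ≤ (r + 1) * r + 1 := by nlinarith
  rcases hj.eq_or_lt with rfl | hj
  · have := hj0 rfl
    exact mul_le_of_le_left (by linarith) hp0 hq hodd hc hk (by rw [ha]; linarith) hs' hab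
  rcases hj'.eq_or_lt with rfl | hj'
  · have := hj0' rfl
    rw [mul_comm]
    exact mul_le_of_le_left (by linarith) hp0 hq hodd hc hl (by rw [hb]; linarith) hs
      (by linarith)
  · rw [ha, hb]
    exact mul_le_of_clique_split hr hp0 hp hs hs' ht ht' hss hjj htt hj hj' hjc

theorem mul_le_of_pendant {r j j' s s' t t' a b c k : ℤ} (hr : 2 ≤ r)
    (hs : 0 ≤ s) (hs' : 0 ≤ s') (ht : 0 ≤ t) (ht' : 0 ≤ t')
    (hj : 0 ≤ j) (hj' : 0 ≤ j') (hss : s + s' = 1) (hjj : j + j' = r + 1) (htt : t + t' = 1)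
    (hc : 1 ≤ c) (hjc : j * j' ≤ c) (hk : a = c + 2 * k)
    (ha : a = s + j * r + t) (hb : b = s' + j' * r + t') (hj0 : j = 0 → t = 0)
    (hj0' : j' = 0 → t' = 0) : a * b ≤ c * (r * (r + 2)) := by
  have hM : 0 < r * (r + 2) := by positivity
  have hcM := mul_le_mul_of_nonneg_right hjc hM.le
  have hcM1 := mul_le_mul_of_nonneg_right hc hM.le
  rcases hj.eq_or_lt with rfl | hj
  · have ht0 := hj0 rfl
    have hj'r : j' = r + 1 := by linarith
    have hs01 : s = 0 ∨ s = 1 := by omega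
    rw [ha, hb, hj'r, ht0]
    rcases hs01 with rfl | rfl <;> nlinarith
  rcases hj'.eq_or_lt with rfl | hj'
  · have ht0 := hj0' rfl
    have hjr : j = r + 1 := by linarith
    have hs01 : s' = 0 ∨ s' = 1 := by omega
    rw [ha, hb, hjr, ht0]
    rcases hs01 with rfl | rfl <;> nlinarith
  have hmixed : s + t = 1 → a * b ≤ c * (r * (r + 2)) := by
    intro hst
    have hne : c ≠ j * j' := by
      rintro rfl
      obtain ⟨w, hw⟩ := Int.even_mul_pred_self j
      have : j * (j - 1) + 1 = 2 * k := by
        have hr' : r = j + j' - 1 := by linarith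
        rw [hr'] at ha
        linarith
      omega
    have hc' : j * j' + 1 ≤ c := by omega
    have h1 := mul_le_mul_of_nonneg_right hc' hM.le
    have h2 : a * b = j * j' * r ^ 2 + r * (r + 1) + 1 := by
      rw [← hjj, ha, hb, show s = 1 - t by linarith, show s' = 1 - t' by linarith]; ring
    have h3 : 0 < j * j' := mul_pos hj hj'
    nlinarith [mul_pos h3 (by linarith : 0 < r)]
  have hs01 : s = 0 ∨ s = 1 := by omega
  have ht01 : t = 0 ∨ t = 1 := by omega
  rcases hs01 with rfl | rfl <;> rcases ht01 with rfl | rfl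
  · have hb' : b = j' * r + 2 := by linarith
    have h : a * b ≤ j * j' * (r * (r + 2)) := by
      rw [ha, hb']
      nlinarith [mul_pos hj (by linarith : 0 < r)]
    linarith
  · exact hmixed (by norm_num)
  · exact hmixed (by norm_num)
  · have ha' : a = j * r + 2 := by linarith
    have hb' : b = j' * r := by linarith
    have h : a * b ≤ j * j' * (r * (r + 2)) := by
      rw [ha', hb']
      nlinarith [mul_pos hj' (by linarith : 0 < r)]
    linarith

theorem exists_lollipop_mul_eq {n m k b : ℕ} (hn : 1 ≤ n) (hk : 1 ≤ k) (hkm : k ≤ m)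
    (hb : 2 * k - 1 + b = n * (n - 1) + 2 * m) :
    ∃ A : Finset (Fin m ⊕ Fin n), A.Nonempty ∧ Aᶜ.Nonempty ∧
      lollipopVol n m A * lollipopVol n m Aᶜ = lollipopCut n m A * ((2 * k - 1) * b) := by
  refine ⟨pathPrefix n m k, ⟨Sum.inl ⟨0, by omega⟩, ?_⟩, ⟨Sum.inr ⟨0, hn⟩, ?_⟩, ?_⟩
  · simp [pathPrefix]; omega
  · simp [pathPrefix]
  · have h := lollipopVol_add_compl hn (hk.trans hkm) (pathPrefix n m k)
    have h1 := lollipopVol_pathPrefix hn hk hkm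
    have h2 : lollipopVol n m (pathPrefix n m k)ᶜ = b := by omega
    rw [h2, h1, lollipopCut_pathPrefix hn hk hkm, one_mul]

theorem exists_lollipop_one_mul_eq {n : ℕ} (hn : 2 ≤ n) :
    ∃ A : Finset (Fin 1 ⊕ Fin n), A.Nonempty ∧ Aᶜ.Nonempty ∧
      lollipopVol n 1 A * lollipopVol n 1 Aᶜ = lollipopCut n 1 A * ((n - 1) * (n + 1)) := by
  have hcut : lollipopCut n 1 (Finset.univ.disjSum {⟨0, by omega⟩}) = n - 1 := by
    rw [lollipopCut_disjSum]
    have h : ∀ i ∈ (Finset.univ : Finset (Fin 1)), ∑ j ∈ ({⟨0, by omega⟩} : Finset (Fin n))ᶜ,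
        lollipopNat n 1 (Sum.inl i) (Sum.inr j) = 0 := by
      refine fun i _ => Finset.sum_eq_zero fun j hj => if_neg ?_
      simpa [Fin.ext_iff] using hj
    simp only [Finset.sum_add_distrib, Finset.sum_eq_zero h, Finset.compl_univ, Finset.sum_empty,
      Finset.sum_const_zero, Finset.card_compl, Finset.card_singleton, Fintype.card_fin]
    omega
  have hvol : lollipopVol n 1 (Finset.univ.disjSum {⟨0, by omega⟩}) = n + 1 := by
    rw [lollipopVol_disjSum (by omega) le_rfl, Finset.sum_singleton, if_pos rfl,
      Finset.card_singleton, show pathVol (Finset.univ : Finset (Fin 1)) = 1 from rfl]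
    omega
  have hadd := lollipopVol_add_compl (by omega) le_rfl
    (Finset.univ.disjSum {⟨0, by omega⟩} : Finset (Fin 1 ⊕ Fin n))
  refine ⟨Finset.univ.disjSum {⟨0, by omega⟩}, ⟨Sum.inl 0, by simp⟩,
    ⟨Sum.inr ⟨1, by omega⟩, by simp [Fin.ext_iff]⟩, ?_⟩
  obtain ⟨r, rfl⟩ : ∃ r, n = r + 1 := ⟨n - 1, by omega⟩
  simp only [Nat.add_sub_cancel] at hadd hcut ⊢
  rw [hvol] at hadd ⊢
  rw [hcut]
  have : lollipopVol (r + 1) 1 (Finset.univ.disjSum {⟨0, by omega⟩})ᶜ = r * r := by nlinarith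
  rw [this]
  ring

theorem mul_le_mul_sq_half {a b c h : ℕ} (hc : 1 ≤ c) (hab : a + b = 2 * h) :
    a * b ≤ c * (h * h) := by
  have h1 : a * b ≤ h * h := by
    zify at hab ⊢
    nlinarith [sq_nonneg ((a : ℤ) - b)]
  exact h1.trans (Nat.le_mul_of_pos_left _ hc)

theorem mul_le_mul_pred_succ {a b c h k : ℕ} (hc : 1 ≤ c) (hh : Even h) (hh2 : 2 ≤ h)
    (hk : a = c + 2 * k) (hab : a + b = 2 * h) : a * b ≤ c * ((h - 1) * (h + 1)) := by
  obtain ⟨w, hw⟩ := hh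
  obtain ⟨g, rfl⟩ : ∃ g, h = g + 1 := ⟨h - 1, by omega⟩
  rw [Nat.add_sub_cancel]
  rcases hc.eq_or_lt with rfl | hc
  · rw [one_mul]
    have hne : a ≤ g ∨ g + 2 ≤ a := by omega
    zify at hab hne ⊢
    have hb : (b : ℤ) = 2 * (g + 1) - a := by linarith
    rw [hb]
    rcases hne with h | h <;> nlinarith
  · have h1 := mul_le_mul_sq_half le_rfl hab
    have h2 := Nat.mul_le_mul_right (g * (g + 1 + 1)) hc
    nlinarith

/-- The value of `Mcut(LP_{n,m})` for the lollipop graph, `n ≥ 3`, `m ≥ 1`. -/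
theorem mcut_lollipop (n m : ℕ) (hn : 3 ≤ n) (hm : 1 ≤ m) :
    (2 ≤ m → 2 * m ≤ n ^ 2 - n + 4 →
      wmcut (lollipopW n m) =
        ((n : ℝ) ^ 2 - n + 2 * m) / ((2 * (m : ℝ) - 1) * ((n : ℝ) ^ 2 - n + 1))) ∧
    (n ^ 2 - n + 4 < 2 * m → 4 ∣ (n ^ 2 - n + 2 * m + 2) →
      wmcut (lollipopW n m) = 4 / ((n : ℝ) ^ 2 - n + 2 * m)) ∧
    (n ^ 2 - n + 4 < 2 * m → ¬ 4 ∣ (n ^ 2 - n + 2 * m + 2) →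
      wmcut (lollipopW n m) =
        4 * ((n : ℝ) ^ 2 - n + 2 * m) /
          (((n : ℝ) * ((n : ℝ) - 1) + 2 * ((m : ℝ) - 1)) *
            ((n : ℝ) * ((n : ℝ) - 1) + 2 * ((m : ℝ) + 1)))) ∧
    (m = 1 →
      wmcut (lollipopW n m) =
        ((n : ℝ) ^ 2 - n + 2) / (((n : ℝ) + 1) * ((n : ℝ) - 1))) := by
  have hsq : n ^ 2 - n = n * (n - 1) := by rw [Nat.mul_sub_one, pow_two]
  have hcast : ((n * (n - 1) + 2 * m : ℕ) : ℝ) = (n : ℝ) ^ 2 - n + 2 * m := by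
    push_cast [Nat.cast_sub (show 1 ≤ n by omega)]
    ring
  have hn1 : 1 ≤ n := by omega
  have hN : 6 ≤ n * (n - 1) := Nat.mul_le_mul hn (show 2 ≤ n - 1 by omega)
  obtain ⟨e, he⟩ := Nat.even_mul_pred_self n
  rw [hsq]
  refine ⟨fun hm2 hle => ?_, fun hlt hdvd => ?_, fun hlt hdvd => ?_, ?_⟩
  · rw [wmcut_eq_div (M := (2 * m - 1) * (n * (n - 1) + 1)) hn1 hm ?_
      (exists_lollipop_mul_eq hn1 hm le_rfl (by omega)), hcast]
    · push_cast [Nat.cast_sub hn1, Nat.cast_sub (show 1 ≤ 2 * m by omega)]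
      ring
    · intro A hA hA'
      obtain ⟨k, l, s, s', j, j', t, t', hc, hk, hl, ha, hb, hs, hj, ht, hjj, hj0, hj0'⟩ :=
        exists_lollipop_data hn1 hm hA hA'
      obtain ⟨r, rfl⟩ : ∃ r, n = r + 1 := ⟨n - 1, by omega⟩
      obtain ⟨p, hp⟩ : ∃ p, 2 * m - 1 = p := ⟨_, rfl⟩
      rw [hp] at hs ⊢
      have hp3 : 3 ≤ p := by omega
      have hpr : p ≤ (r + 1) * (r + 1 - 1) + 3 := by omega
      simp only [Nat.add_sub_cancel] at hpr ha hb ⊢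
      zify at *
      exact mul_le_of_le_quadratic (by linarith) hp3 hpr (by positivity) (by positivity)
        (by positivity) (by positivity) (by positivity) (by positivity) hs hj ht hc hjj hk hl
        ha hb hj0 hj0'
  · have hh : ((e + m : ℕ) : ℝ) * 2 = (n : ℝ) ^ 2 - n + 2 * m := by
      rw [← hcast, he]; push_cast; ring
    have hpos : (0 : ℝ) < ((e + m : ℕ) : ℝ) := by exact_mod_cast (by omega : 0 < e + m)
    have hex := exists_lollipop_mul_eq (m := m) (k := (e + m + 1) / 2) (b := e + m) hn1
      (by omega) (by omega) (by omega)
    rw [show 2 * ((e + m + 1) / 2) - 1 = e + m by omega] at hex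
    rw [wmcut_eq_div hn1 hm ?_ hex, hcast, ← hh]
    · push_cast at hpos ⊢
      field_simp
      ring
    · intro A hA hA'
      obtain ⟨k, l, -, -, -, -, -, -, hc, -⟩ := exists_lollipop_data hn1 hm hA hA'
      have hadd := lollipopVol_add_compl hn1 hm A
      exact mul_le_mul_sq_half hc (by omega)
  · have hh : ((e + m : ℕ) : ℝ) * 2 = (n : ℝ) ^ 2 - n + 2 * m := by
      rw [← hcast, he]; push_cast; ring
    have hpos : (1 : ℝ) < ((e + m : ℕ) : ℝ) := by exact_mod_cast (by omega : 1 < e + m)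
    have hex := exists_lollipop_mul_eq (m := m) (k := (e + m) / 2) (b := e + m + 1) hn1
      (by omega) (by omega) (by omega)
    rw [show 2 * ((e + m) / 2) - 1 = e + m - 1 by omega] at hex
    rw [wmcut_eq_div hn1 hm ?_ hex, hcast, ← hh,
      show (n : ℝ) * (n - 1) + 2 * (m - 1) = 2 * (((e + m : ℕ) : ℝ) - 1) by linarith,
      show (n : ℝ) * (n - 1) + 2 * (m + 1) = 2 * (((e + m : ℕ) : ℝ) + 1) by linarith]
    · rw [Nat.cast_mul, Nat.cast_sub (by omega), Nat.cast_add (e + m) 1, Nat.cast_one]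
      have : (0 : ℝ) < ((e + m : ℕ) : ℝ) - 1 := by linarith
      field_simp
      ring
    · intro A hA hA'
      obtain ⟨k, l, -, -, -, -, -, -, hc, hk, -⟩ := exists_lollipop_data hn1 hm hA hA'
      have hadd := lollipopVol_add_compl hn1 hm A
      exact mul_le_mul_pred_succ hc (Nat.even_iff.2 (by omega)) (by omega) hk (by omega)
  · rintro rfl
    rw [wmcut_eq_div hn1 hm ?_ (exists_lollipop_one_mul_eq (by omega)), hcast]
    · push_cast [Nat.cast_sub hn1]
      ring
    · intro A hA hA'
      obtain ⟨k, l, s, s', j, j', t, t', hc, hk, hl, ha, hb, hs, hj, ht, hjj, hj0, hj0'⟩ :=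
        exists_lollipop_data hn1 hm hA hA'
      obtain ⟨r, rfl⟩ : ∃ r, n = r + 1 := ⟨n - 1, by omega⟩
      simp only [Nat.add_sub_cancel, Nat.mul_one, Nat.reduceSub] at ha hb hs ⊢
      zify at *
      exact mul_le_of_pendant (by linarith) (by positivity) (by positivity) (by positivity)
        (by positivity) (by positivity) (by positivity) hs hj ht hc hjj hk ha hb hj0 hj0'
end

section
/- For k ≥ 3, the second smallest eigenvalue λ₂(𝓛(P_{2k,k})) of the normalized Laplacian of the weighted path P_{2k,k} satisfies λ₂(𝓛(P_{2k,k})) ≥ 1 − cos(π/(4k − 1)). -/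
open Finset

/-- The normalized Laplacian `D^{-1/2}(D - W)D^{-1/2}` of a weighted graph. -/
noncomputable def normLap {V : Type} [Fintype V] [DecidableEq V] (W : Matrix V V ℝ) :
    Matrix V V ℝ :=
  Matrix.of fun i j =>
    ((if i = j then wdeg W i else 0) - W i j) /
      (Real.sqrt (wdeg W i) * Real.sqrt (wdeg W j))

/-- The weight matrix of the weighted path `P_{n,k}`: a path on `n + k` vertices with
unit edge weights, together with a self-loop of weight `1` at each of the last `k`
vertices. -/
noncomputable def wpathW (n k : ℕ) : Matrix (Fin (n + k)) (Fin (n + k)) ℝ :=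
  Matrix.of fun i j =>
    (if i.val + 1 = j.val ∨ j.val + 1 = i.val then 1 else 0) +
      (if i = j ∧ n ≤ i.val then 1 else 0)

/-- The eigenvalues of a Hermitian matrix sorted in increasing order. -/
noncomputable def sortedEig {n : ℕ} {A : Matrix (Fin n) (Fin n) ℝ} (hA : A.IsHermitian) :
    Fin n → ℝ :=
  hA.eigenvalues ∘ Tuple.sort hA.eigenvalues

/-- If the quadratic form of `A` is bounded below by `μ` on a hyperplane, then the second
smallest eigenvalue of `A` is at least `μ`. -/
theorem le_sortedEig_one_of_forall_dotProduct_eq_zero {N : ℕ} {A : Matrix (Fin N) (Fin N) ℝ}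
    (hA : A.IsHermitian) (hN : 1 < N) (μ : ℝ) (e : Fin N → ℝ)
    (h : ∀ x : Fin N → ℝ, e ⬝ᵥ x = 0 → μ * (x ⬝ᵥ x) ≤ x ⬝ᵥ A.mulVec x) :
    μ ≤ sortedEig hA ⟨1, hN⟩ := by
  set i := Tuple.sort hA.eigenvalues ⟨0, by omega⟩ with hi
  set j := Tuple.sort hA.eigenvalues ⟨1, hN⟩ with hj
  have hij : i ≠ j := by
    intro hc
    have := (Tuple.sort hA.eigenvalues).injective hc
    simp at this
  have hle : hA.eigenvalues i ≤ hA.eigenvalues j :=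
    Tuple.monotone_sort hA.eigenvalues (by simp [Fin.le_def])
  have hdot (a b : Fin N) : ⇑(hA.eigenvectorBasis a) ⬝ᵥ ⇑(hA.eigenvectorBasis b) =
      if a = b then 1 else 0 := by
    have := orthonormal_iff_ite.mp hA.eigenvectorBasis.orthonormal b a
    simpa [EuclideanSpace.inner_eq_star_dotProduct, eq_comm] using this
  set v : Fin N → ℝ := ⇑(hA.eigenvectorBasis i) with hv
  set w : Fin N → ℝ := ⇑(hA.eigenvectorBasis j) with hw
  have hvv : v ⬝ᵥ v = 1 := by simp [hv, hdot]
  have hww : w ⬝ᵥ w = 1 := by simp [hw, hdot]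
  have hvw : v ⬝ᵥ w = 0 := by simp [hv, hw, hdot, hij]
  have hwv : w ⬝ᵥ v = 0 := by rw [dotProduct_comm, hvw]
  have hAv : A.mulVec v = hA.eigenvalues i • v := hA.mulVec_eigenvectorBasis i
  have hAw : A.mulVec w = hA.eigenvalues j • w := hA.mulVec_eigenvectorBasis j
  obtain ⟨a, b, hab, he⟩ : ∃ a b : ℝ, 0 < a ^ 2 + b ^ 2 ∧ a * (e ⬝ᵥ v) + b * (e ⬝ᵥ w) = 0 := by
    by_cases h0 : e ⬝ᵥ w = 0
    · exact ⟨0, 1, by norm_num, by simp [h0]⟩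
    · exact ⟨e ⬝ᵥ w, -(e ⬝ᵥ v), by positivity, by ring⟩
  have key := h (a • v + b • w) (by simpa [dotProduct_add] using he)
  simp only [Matrix.mulVec_add, Matrix.mulVec_smul, hAv, hAw, dotProduct_add, add_dotProduct,
    smul_dotProduct, dotProduct_smul, hvv, hww, hvw, hwv, smul_eq_mul] at key
  change μ ≤ hA.eigenvalues j
  nlinarith [mul_nonneg (sq_nonneg a) (sub_nonneg.2 hle)]

/-- A Barta-type bound: a positive supersolution `h` for the rank-one modification `W - e eᵀ` of
the weights bounds the quadratic form of the normalized Laplacian from below on the hyperplane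
orthogonal to `D^{-1/2} e`. -/
theorem mul_dotProduct_le_dotProduct_normLap_mulVec {V : Type} [Fintype V] [DecidableEq V]
    (W : Matrix V V ℝ) (hW : ∀ i j, W i j = W j i) (hd : ∀ i, 0 < wdeg W i) (μ : ℝ)
    (e h : V → ℝ) (he : ∀ i j, i ≠ j → e i * e j ≤ W i j) (hh : ∀ i, 0 < h i)
    (hsup : ∀ i, ∑ j, W i j * h j - e i * ∑ j, e j * h j ≤ (1 - μ) * wdeg W i * h i)
    (x : V → ℝ) (hx : (fun i => e i / Real.sqrt (wdeg W i)) ⬝ᵥ x = 0) :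
    μ * (x ⬝ᵥ x) ≤ x ⬝ᵥ (normLap W).mulVec x := by
  obtain ⟨f, rfl⟩ : ∃ f : V → ℝ, x = fun i => Real.sqrt (wdeg W i) * f i :=
    ⟨fun i => x i / Real.sqrt (wdeg W i), funext fun i => by
      field_simp [(Real.sqrt_pos.2 (hd i)).ne']⟩
  have hs (i : V) : Real.sqrt (wdeg W i) ≠ 0 := (Real.sqrt_pos.2 (hd i)).ne'
  have hef : ∑ i, e i * f i = 0 := by
    rw [← hx]
    refine sum_congr rfl fun i _ => ?_
    field_simp [hs i]
  have hxx : (fun i => Real.sqrt (wdeg W i) * f i) ⬝ᵥ (fun i => Real.sqrt (wdeg W i) * f i)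
      = ∑ i, wdeg W i * f i ^ 2 := by
    refine sum_congr rfl fun i _ => ?_
    rw [mul_mul_mul_comm, Real.mul_self_sqrt (hd i).le, sq]
  have hxL : (fun i => Real.sqrt (wdeg W i) * f i) ⬝ᵥ
      (normLap W).mulVec (fun i => Real.sqrt (wdeg W i) * f i)
      = ∑ i, wdeg W i * f i ^ 2 - ∑ i, ∑ j, (W i j - e i * e j) * (f i * f j) := by
    have h0 : ∑ i, ∑ j, (e i * e j) * (f i * f j) = 0 := by
      calc _ = (∑ i, e i * f i) * ∑ j, e j * f j := by
            rw [sum_mul_sum]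
            exact sum_congr rfl fun i _ => sum_congr rfl fun j _ => by ring
        _ = 0 := by rw [hef, zero_mul]
    simp only [sub_mul (W _ _), sum_sub_distrib, h0, sub_zero]
    rw [← sum_sub_distrib]
    refine sum_congr rfl fun i _ => ?_
    have hi : wdeg W i * f i ^ 2 = ∑ j, (if i = j then wdeg W i else 0) * (f i * f j) := by
      simp [sq]
    rw [hi, ← sum_sub_distrib, Matrix.mulVec, dotProduct, mul_sum]
    refine sum_congr rfl fun j _ => ?_
    simp only [normLap, Matrix.of_apply]
    have := hs i
    have := hs j
    field_simp
  rw [hxx, hxL]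
  have hamgm (i j : V) : (W i j - e i * e j) * (f i * f j) ≤
      ((W i j - e i * e j) * (f i ^ 2 / h i * h j) +
        (W i j - e i * e j) * (f j ^ 2 / h j * h i)) / 2 := by
    by_cases hij : i = j
    · subst hij
      have := (hh i).ne'
      apply le_of_eq
      field_simp
      ring
    · have h1 : f i * f j ≤ (f i ^ 2 / h i * h j + f j ^ 2 / h j * h i) / 2 := by
        have hi := hh i
        have hj := hh j
        have : (f i ^ 2 / h i * h j + f j ^ 2 / h j * h i) / 2 - f i * f j
            = (f i * h j - f j * h i) ^ 2 / (2 * h i * h j) := by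
          field_simp
          ring
        have : 0 ≤ (f i * h j - f j * h i) ^ 2 / (2 * h i * h j) := by positivity
        linarith
      have := mul_le_mul_of_nonneg_left h1 (sub_nonneg.2 (he i j hij))
      linarith
  have hsum : ∑ i, ∑ j, (W i j - e i * e j) * (f i * f j) ≤
      ∑ i, ∑ j, (W i j - e i * e j) * (f i ^ 2 / h i * h j) := by
    have hsymm : ∑ i, ∑ j, (W i j - e i * e j) * (f j ^ 2 / h j * h i) =
        ∑ i, ∑ j, (W i j - e i * e j) * (f i ^ 2 / h i * h j) := by
      rw [sum_comm]
      refine sum_congr rfl fun i _ => sum_congr rfl fun j _ => ?_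
      rw [hW j i, mul_comm (e j)]
    refine (sum_le_sum fun i _ => sum_le_sum fun j _ => hamgm i j).trans (le_of_eq ?_)
    simp only [← sum_div, sum_add_distrib, hsymm]
    ring
  have hrow (i : V) : ∑ j, (W i j - e i * e j) * (f i ^ 2 / h i * h j) ≤
      (1 - μ) * (wdeg W i * f i ^ 2) := by
    have hi := hh i
    calc _ = f i ^ 2 / h i * (∑ j, W i j * h j - e i * ∑ j, e j * h j) := by
          rw [mul_sum, ← sum_sub_distrib, mul_sum]
          exact sum_congr rfl fun j _ => by ring
      _ ≤ f i ^ 2 / h i * ((1 - μ) * wdeg W i * h i) :=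
          mul_le_mul_of_nonneg_left (hsup i) (by positivity)
      _ = _ := by field_simp
  have := sum_le_sum fun i (_ : i ∈ univ) => hrow i
  rw [← mul_sum] at this
  linarith

theorem sum_wpathW_mul (n k : ℕ) (u : ℕ → ℝ) (i : Fin (n + k)) :
    ∑ j, wpathW n k i j * u j = (if i.val + 1 < n + k then u (i + 1) else 0) +
      (if 1 ≤ i.val then u (i - 1) else 0) + (if n ≤ i.val then u i else 0) := by
  obtain ⟨i, hi⟩ := i
  have hterm (j : Fin (n + k)) : wpathW n k ⟨i, hi⟩ j * u j =
      (if i + 1 = j.val then u j else 0) +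
        (if 1 ≤ i then (if i - 1 = j.val then u j else 0) else 0) +
        (if n ≤ i then (if i = j.val then u j else 0) else 0) := by
    simp only [wpathW, Matrix.of_apply, Fin.ext_iff]
    split_ifs <;> first | omega | simp
  simp only [hterm, sum_add_distrib]
  have hs (m : ℕ) : ∑ j : Fin (n + k), (if m = j.val then u j else 0) =
      if m < n + k then u m else 0 := by
    rw [Fin.sum_univ_eq_sum_range (fun j => if m = j then u j else 0)]
    simp
  rw [hs]
  congr 1
  · congr 1
    split_ifs
    · rw [hs, if_pos (by omega)]
    · simp
  · split_ifs
    · rw [hs, if_pos hi]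
    · simp

theorem wdeg_wpathW (n k : ℕ) (i : Fin (n + k)) :
    wdeg (wpathW n k) i = (if i.val + 1 < n + k then 1 else 0) +
      (if 1 ≤ i.val then 1 else 0) + (if n ≤ i.val then 1 else 0) := by
  simpa [wdeg] using sum_wpathW_mul n k (fun _ => 1) i

theorem two_mul_cos_pi_div_add_one_le (k : ℕ) (hk : 3 ≤ k) :
    2 * Real.cos (Real.pi / (2 * k)) + 1 ≤ 3 * Real.cos (Real.pi / (4 * (k : ℝ) - 1)) := by
  have hk' : (3 : ℝ) ≤ k := by exact_mod_cast hk
  have hpi := Real.pi_gt_three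
  have hpi4 := Real.pi_lt_d2
  set ψ := Real.pi / (2 * (k : ℝ)) with hψ
  set φ := Real.pi / (4 * (k : ℝ) - 1) with hφ
  have hφ0 : 0 < φ := div_pos (by linarith) (by linarith)
  have hψ0 : 0 < ψ := div_pos (by linarith) (by linarith)
  have h1 : φ * (4 * (k : ℝ) - 1) = Real.pi := div_mul_cancel₀ _ (by linarith)
  have h2 : ψ * (2 * (k : ℝ)) = Real.pi := div_mul_cancel₀ _ (by linarith)
  have hψ1 : ψ ≤ 3 / 5 := by nlinarith
  have hle : 11 / 6 * φ ≤ ψ := by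
    rw [hψ, hφ, ← mul_div_assoc, div_le_div_iff₀ (by linarith) (by linarith)]
    nlinarith
  have hsq : 3 * φ ^ 2 ≤ ψ ^ 2 := by nlinarith
  have hc := (abs_le.1 (Real.cos_bound (x := ψ) (by rw [abs_of_pos hψ0]; linarith))).2
  rw [abs_of_pos hψ0] at hc
  have hc' := Real.one_sub_sq_div_two_le_cos (x := φ)
  have h4 : ψ ^ 4 ≤ ψ ^ 2 :=
    pow_le_pow_of_le_one hψ0.le (by linarith) (by norm_num)
  nlinarith [sq_nonneg ψ]

theorem sin_add_half_add (m ψ : ℝ) :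
    Real.sin ((m + 1 + 1 / 2) * ψ) + Real.sin ((m - 1 + 1 / 2) * ψ) =
      2 * Real.cos ψ * Real.sin ((m + 1 / 2) * ψ) := by
  rw [show (m + 1 + 1 / 2) * ψ = (m + 1 / 2) * ψ + ψ by ring,
    show (m - 1 + 1 / 2) * ψ = (m + 1 / 2) * ψ - ψ by ring, Real.sin_add, Real.sin_sub]
  ring

theorem cos_add_one_mul_add (m φ : ℝ) :
    Real.cos ((m + 1) * φ) + Real.cos ((m - 1) * φ) = 2 * Real.cos φ * Real.cos (m * φ) := by
  rw [add_mul, sub_mul, one_mul, Real.cos_add, Real.cos_sub]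
  ring

/-- For `k ≥ 3`, the second smallest eigenvalue of the normalized Laplacian of the
weighted path `P_{2k,k}` satisfies `λ₂ ≥ 1 − cos(π/(4k−1))`. -/
theorem secondEigenvalue_wpath_lower_bound (k : ℕ) (hk : 3 ≤ k)
    (hH : (normLap (wpathW (2 * k) k)).IsHermitian) :
    1 - Real.cos (Real.pi / (4 * (k : ℝ) - 1)) ≤ sortedEig hH ⟨1, by omega⟩ := by
  have hk' : (3 : ℝ) ≤ k := by exact_mod_cast hk
  have hpi := Real.pi_pos
  have h3 := two_mul_cos_pi_div_add_one_le k hk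
  set ψ := Real.pi / (2 * (k : ℝ)) with hψ
  set φ := Real.pi / (4 * (k : ℝ) - 1) with hφ
  have hφ0 : 0 < φ := div_pos hpi (by linarith)
  have hψ0 : 0 < ψ := div_pos hpi (by linarith)
  have h1 : φ * (4 * (k : ℝ) - 1) = Real.pi := div_mul_cancel₀ _ (by linarith)
  have h2 : ψ * (2 * (k : ℝ)) = Real.pi := div_mul_cancel₀ _ (by linarith)
  have hcos : Real.cos ψ ≤ Real.cos φ := by linarith [Real.cos_le_one ψ]
  let h : ℕ → ℝ := fun i =>
    if i < 2 * k then Real.cos (i * φ) else Real.sin (((i : ℝ) - 2 * k + 1 / 2) * ψ)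
  have hl (i : ℕ) (hi : i < 2 * k) : h i = Real.cos (i * φ) := if_pos hi
  have hr (i : ℕ) (hi : 2 * k ≤ i) : h i = Real.sin (((i : ℝ) - 2 * k + 1 / 2) * ψ) :=
    if_neg (by omega)
  have hpos (i : ℕ) (hi : i < 2 * k + k) : 0 < h i := by
    rcases lt_or_ge i (2 * k) with hlt | hge
    · rw [hl i hlt]
      have : (i : ℝ) + 1 ≤ 2 * k := by exact_mod_cast hlt
      have : 0 ≤ (i : ℝ) * φ := by positivity
      exact Real.cos_pos_of_mem_Ioo ⟨by linarith, by nlinarith⟩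
    · rw [hr i hge]
      have hi1 : (i : ℝ) + 1 ≤ 3 * k := by exact_mod_cast (by omega : i + 1 ≤ 3 * k)
      have hi2 : (2 * k : ℝ) ≤ i := by exact_mod_cast hge
      exact Real.sin_pos_of_pos_of_lt_pi (mul_pos (by linarith) hψ0) (by nlinarith)
  let e : ℕ → ℝ := fun i => (if i = 2 * k - 1 then 1 else 0) + (if i = 2 * k then 1 else 0)
  have he0 (i : ℕ) (hi : i ≠ 2 * k - 1) (hi' : i ≠ 2 * k) : e i = 0 := by simp [e, hi, hi']
  have he1 : e (2 * k - 1) = 1 := by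
    simp only [e]
    rw [if_pos trivial, if_neg (by omega), add_zero]
  have he2 : e (2 * k) = 1 := by
    simp only [e]
    rw [if_pos trivial, if_neg (by omega), zero_add]
  have heh : ∑ j : Fin (2 * k + k), e j * h j = h (2 * k - 1) + h (2 * k) := by
    rw [Fin.sum_univ_eq_sum_range (fun j => e j * h j)]
    simp only [e, add_mul, ite_mul, one_mul, zero_mul, sum_add_distrib]
    simp only [sum_ite_eq', mem_range]
    rw [if_pos (by omega), if_pos (by omega)]
  refine le_sortedEig_one_of_forall_dotProduct_eq_zero hH (by omega) _ _
    (mul_dotProduct_le_dotProduct_normLap_mulVec (wpathW (2 * k) k) ?_ ?_ _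
      (fun i => e i) (fun i => h i) ?_ (fun i => hpos i i.2) ?_)
  · intro i j
    simp only [wpathW, Matrix.of_apply, Fin.ext_iff]
    split_ifs <;> first | omega | rfl
  · intro i
    rw [wdeg_wpathW]
    have := i.2
    split_ifs <;> first | omega | norm_num
  · intro i j hij
    have : i.val ≠ j.val := fun hc => hij (Fin.ext hc)
    simp only [wpathW, Matrix.of_apply, Fin.ext_iff, e]
    split_ifs <;> first | omega | norm_num
  · rintro ⟨i, hi⟩
    rw [sum_wpathW_mul, heh, wdeg_wpathW]
    simp only [sub_sub_cancel]
    have hmid (i : ℕ) (hi : 2 * k + 1 ≤ i) : h (i + 1) + h (i - 1) = 2 * Real.cos ψ * h i := by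
      rw [hr _ (by omega), hr _ (by omega), hr i (by omega), ← sin_add_half_add]
      push_cast [show 1 ≤ i by omega]
      ring_nf
    rcases lt_trichotomy i (2 * k - 1) with hlt | rfl | hgt
    · simp only [if_pos (show i + 1 < 2 * k + k by omega), if_neg (show ¬ 2 * k ≤ i by omega),
        he0 i (by omega) (by omega)]
      rcases Nat.eq_zero_or_pos i with rfl | h0
      · simp [hl 1 (by omega), hl 0 (by omega)]
      · rw [if_pos (by omega), if_pos (by omega), hl _ (by omega), hl _ (by omega),
          hl i (by omega)]
        have := cos_add_one_mul_add i φ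
        push_cast [show 1 ≤ i by omega]
        linarith
    · rw [if_pos (by omega), if_pos (by omega), if_neg (by omega), if_pos (by omega),
        if_pos (by omega), if_neg (by omega), he1,
        show 2 * k - 1 + 1 = 2 * k by omega, hl (2 * k - 1) (by omega),
        hl (2 * k - 1 - 1) (by omega)]
      have := cos_add_one_mul_add ((2 * k - 1 : ℕ) : ℝ) φ
      push_cast [show 1 ≤ 2 * k by omega, show 1 ≤ 2 * k - 1 by omega] at this ⊢
      have hrefl : Real.cos ((2 * (k : ℝ) - 1 + 1) * φ) = -Real.cos ((2 * (k : ℝ) - 1) * φ) := by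
        rw [← Real.cos_pi_sub]
        congr 1
        linarith
      linarith
    · rcases eq_or_lt_of_le (show 2 * k ≤ i by omega) with rfl | hgt'
      · rw [if_pos (by omega), if_pos (by omega), if_pos le_rfl, if_pos (by omega),
          if_pos (by omega), if_pos le_rfl, he2]
        have hs := sin_add_half_add 0 ψ
        have hp := hpos (2 * k) hi
        have ha : h (2 * k) = Real.sin ((0 + 1 / 2) * ψ) := by
          rw [hr _ le_rfl]
          push_cast
          ring_nf
        have hb : h (2 * k + 1) = Real.sin ((0 + 1 + 1 / 2) * ψ) := by
          rw [hr _ (by omega)]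
          push_cast
          ring_nf
        rw [show (0 - 1 + 1 / 2 : ℝ) * ψ = -((0 + 1 / 2) * ψ) by ring, Real.sin_neg,
          ← ha, ← hb] at hs
        nlinarith
      · have hm := hmid i hgt'
        have hp := hpos i hi
        rw [if_pos (by omega : 1 ≤ i), if_pos (by omega : 2 * k ≤ i),
          if_pos (by omega : 1 ≤ i), if_pos (by omega : 2 * k ≤ i), he0 i (by omega) (by omega)]
        by_cases hend : i + 1 < 2 * k + k
        · rw [if_pos hend, if_pos hend]
          nlinarith
        · rw [if_neg hend, if_neg hend]
          have hlast : h (i + 1) = h i := by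
            have hik : (i : ℝ) = 3 * k - 1 := by
              rw [eq_sub_iff_add_eq]
              exact_mod_cast (by omega : i + 1 = 3 * k)
            rw [hr _ (by omega), hr i (by omega), ← Real.sin_pi_sub]
            congr 1
            push_cast
            rw [hik]
            linarith
          nlinarith
end
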